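/- arXiv:2006.06333 — 4 statements merged into one kernel-verified Lean document; each statement's English description precedes it below -/
import Mathlib

section
/- The induced subdigraph D[V(D)∖V(P)] is either a semicomplete digraph, a semicomplete bipartite digraph, or an empty digraph (a digraph with no arcs). -/
variable {V : Type*}

/-- Two vertices are adjacent in the digraph with arc relation `A`. -/
def DAdj (A : V → V → Prop) (x y : V) : Prop := A x y ∨ A y x

/-- `x 0, x 1, …, x n` is a directed path of length `n` (distinct vertices, consecutive arcs). -/
def IsDipathOn (A : V → V → Prop) (n : ℕ) (x : ℕ → V) : Prop :=
  (∀ i j, i ≤ n → j ≤ n → x i = x j → i = j) ∧ ∀ i, i < n → A (x i) (x (i + 1))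

/-- There is a directed path of length `n` from `u` to `v`. -/
def HasDipath (A : V → V → Prop) (n : ℕ) (u v : V) : Prop :=
  ∃ x : ℕ → V, IsDipathOn A n x ∧ x 0 = u ∧ x n = v

/-- A digraph is `k`-quasi-transitive if the endpoints of every path of length `k` are adjacent. -/
def KQuasiTransitive (A : V → V → Prop) (k : ℕ) : Prop :=
  ∀ x : ℕ → V, IsDipathOn A k x → DAdj A (x 0) (x k)

/-- A digraph is strong if every vertex is reachable from every other vertex. -/
def StrongD (A : V → V → Prop) : Prop := ∀ u v : V, ∃ n, HasDipath A n u v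

/-- The subdigraph induced on `S` is semicomplete. -/
def SemicompleteOn (A : V → V → Prop) (S : Set V) : Prop :=
  ∀ x ∈ S, ∀ y ∈ S, x ≠ y → DAdj A x y

/-- The subdigraph induced on `S` is semicomplete bipartite. -/
def SemicompleteBipartiteOn (A : V → V → Prop) (S : Set V) : Prop :=
  ∃ X Y : Set V, X ∪ Y = S ∧ X ∩ Y = ∅ ∧
    (∀ x ∈ X, ∀ y ∈ X, ¬ DAdj A x y) ∧
    (∀ x ∈ Y, ∀ y ∈ Y, ¬ DAdj A x y) ∧
    (∀ x ∈ X, ∀ y ∈ Y, DAdj A x y)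

/-- The subdigraph induced on `S` has no arcs. -/
def EmptyOn (A : V → V → Prop) (S : Set V) : Prop :=
  ∀ x ∈ S, ∀ y ∈ S, ¬ A x y

/-- The vertex set `{P 0, …, P n}` of a path. -/
def VertsUpTo (n : ℕ) (P : ℕ → V) : Set V := {w | ∃ i ≤ n, P i = w}

/-- The odd-indexed vertices among `{P 0, …, P n}`. -/
def OddVertsUpTo (n : ℕ) (P : ℕ → V) : Set V := {w | ∃ i, i ≤ n ∧ Odd i ∧ P i = w}

/-- The even-indexed vertices among `{P 0, …, P n}`. -/
def EvenVertsUpTo (n : ℕ) (P : ℕ → V) : Set V := {w | ∃ i, i ≤ n ∧ Even i ∧ P i = w}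

/-- `I`: vertices outside `S` receiving no arc from `S`. -/
def ISet (A : V → V → Prop) (S : Set V) : Set V :=
  {x | x ∉ S ∧ ∀ w ∈ S, ¬ A w x}

/-- `W`: vertices outside `S` sending no arc to `S`. -/
def WSet (A : V → V → Prop) (S : Set V) : Set V :=
  {x | x ∉ S ∧ ∀ w ∈ S, ¬ A x w}

/-- `B`: vertices outside `S` that are in neither `I` nor `W`. -/
def BSet (A : V → V → Prop) (S : Set V) : Set V :=
  {x | x ∉ S ∧ x ∉ ISet A S ∧ x ∉ WSet A S}

/-- There is a directed path of length `n` from `u` to `v` all of whose vertices lie in `S`. -/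
def PathIn (A : V → V → Prop) (S : Set V) (n : ℕ) (u v : V) : Prop :=
  ∃ x : ℕ → V, IsDipathOn A n x ∧ x 0 = u ∧ x n = v ∧ ∀ i, i ≤ n → x i ∈ S

/-- The vertices `P a, …, P b`. -/
def Segment (P : ℕ → V) (a b : ℕ) : Set V := {w | ∃ i, a ≤ i ∧ i ≤ b ∧ P i = w}

/-- `x` is not one of the vertices `P 0, …, P (k + 2)`. -/
def OffPath (k : ℕ) (P : ℕ → V) (x : V) : Prop := ∀ i, i ≤ k + 2 → P i ≠ x

namespace PathIn

variable {A : V → V → Prop} {S T : Set V} {m n : ℕ} {u v w z : V}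

theorem single (h : u ∈ S) : PathIn A S 0 u u :=
  ⟨fun _ => u, ⟨fun i j hi hj _ => by omega, fun i hi => by omega⟩, rfl, rfl, fun _ _ => h⟩

theorem mono (h : PathIn A S n u v) (hST : S ⊆ T) : PathIn A T n u v := by
  obtain ⟨x, hx, h0, hn, hS⟩ := h
  exact ⟨x, hx, h0, hn, fun i hi => hST (hS i hi)⟩

theorem cat (h : PathIn A S m u v) (ha : A v w) (h' : PathIn A T n w z)
    (hd : ∀ a ∈ S, a ∉ T) : PathIn A (S ∪ T) (m + n + 1) u z := by
  obtain ⟨x, ⟨hxi, hxa⟩, hx0, hxm, hxS⟩ := h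
  obtain ⟨y, ⟨hyi, hya⟩, hy0, hyn, hyT⟩ := h'
  refine ⟨fun t => if t ≤ m then x t else y (t - (m + 1)), ⟨?_, ?_⟩, ?_, ?_, ?_⟩
  · intro i j hi hj hij
    simp only at hij
    split_ifs at hij with h1 h2 h2
    · exact hxi i j h1 h2 hij
    · exact absurd (hyT (j - (m + 1)) (by omega)) (hij ▸ hd _ (hxS i h1))
    · exact absurd (hyT (i - (m + 1)) (by omega)) (hij ▸ hd _ (hxS j h2))
    · have := hyi _ _ (by omega) (by omega) hij
      omega
  · intro i hi
    rcases lt_trichotomy i m with h1 | h1 | h1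
    · simp only [h1.le, if_true, show i + 1 ≤ m by omega]
      exact hxa i h1
    · subst h1
      simp [hxm, hy0, ha]
    · simp only [show ¬ i ≤ m by omega, show ¬ i + 1 ≤ m by omega, if_false]
      have := hya (i - (m + 1)) (by omega)
      rwa [show i - (m + 1) + 1 = i + 1 - (m + 1) by omega] at this
  · simp [hx0]
  · simp only [show ¬ m + n + 1 ≤ m by omega, if_false]
    rw [show m + n + 1 - (m + 1) = n by omega, hyn]
  · intro i hi
    simp only
    split_ifs with h1
    · exact Or.inl (hxS i h1)
    · exact Or.inr (hyT _ (by omega))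

theorem cons (ha : A u v) (h : PathIn A S n v w) (hu : u ∉ S) :
    PathIn A ({u} ∪ S) (n + 1) u w := by
  have := (single (A := A) (Set.mem_singleton u)).cat ha h (by rintro a rfl; exact hu)
  rwa [show 0 + n + 1 = n + 1 by omega] at this

theorem snoc (h : PathIn A S n u v) (ha : A v w) (hw : w ∉ S) :
    PathIn A (S ∪ {w}) (n + 1) u w :=
  h.cat ha (single (A := A) (Set.mem_singleton w)) (by rintro a haS rfl; exact hw haS)

theorem rev (h : PathIn A S n u v) : PathIn (fun a b => A b a) S n v u := by
  obtain ⟨x, ⟨hxi, hxa⟩, hx0, hxn, hxS⟩ := h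
  refine ⟨fun t => x (n - t), ⟨?_, ?_⟩, by simpa using hxn, by simpa using hx0,
    fun i _ => hxS _ (by omega)⟩
  · intro i j hi hj hij
    have := hxi _ _ (by omega) (by omega) hij
    omega
  · intro i hi
    have := hxa (n - (i + 1)) (by omega)
    rwa [show n - (i + 1) + 1 = n - i by omega] at this

end PathIn

theorem KQuasiTransitive.adj {A : V → V → Prop} {k : ℕ} (h : KQuasiTransitive A k) {S : Set V}
    {u v : V} {n : ℕ} (hp : PathIn A S n u v) (hn : n = k) : DAdj A u v := by
  obtain ⟨x, hx, h0, hk, -⟩ := hp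
  subst hn
  rw [← h0, ← hk]
  exact h x hx

theorem DAdj.symm {A : V → V → Prop} {x y : V} (h : DAdj A x y) : DAdj A y x := Or.symm h

/-- A strong `k`-quasi-transitive digraph, `k ≥ 5` odd, with a path `P 0, …, P (k + 2)` that
cannot be shortcut by an arc or by a walk with one or two intermediate vertices. -/
structure LongGeodesic (A : V → V → Prop) (k : ℕ) (P : ℕ → V) : Prop where
  five_le : 5 ≤ k
  odd : k % 2 = 1
  qt : KQuasiTransitive A k
  inj : ∀ i j, i ≤ k + 2 → j ≤ k + 2 → P i = P j → i = j
  arc : ∀ i, i < k + 2 → A (P i) (P (i + 1))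
  le_one : ∀ i j, i ≤ k + 2 → j ≤ k + 2 → A (P j) (P i) → i ≤ j + 1
  le_two : ∀ i j x, i ≤ k + 2 → j ≤ k + 2 → A (P j) x → A x (P i) → i ≤ j + 2
  le_three : ∀ i j x y, i ≤ k + 2 → j ≤ k + 2 → A (P j) x → A x y → A y (P i) → i ≤ j + 3
  reach : ∀ a b, Relation.ReflTransGen A a b

namespace LongGeodesic

variable {A : V → V → Prop} {k : ℕ} {P : ℕ → V}

theorem rev (G : LongGeodesic A k P) :
    LongGeodesic (fun a b => A b a) k (fun i => P (k + 2 - i)) where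
  five_le := G.five_le
  odd := G.odd
  qt := by
    intro x hx
    have h := PathIn.rev (S := Set.univ) ⟨x, hx, rfl, rfl, fun _ _ => trivial⟩
    exact G.qt.adj h rfl
  inj := fun i j hi hj h => by
    have := G.inj _ _ (by omega) (by omega) h
    omega
  arc := fun i hi => by
    have := G.arc (k + 2 - (i + 1)) (by omega)
    rwa [show k + 2 - (i + 1) + 1 = k + 2 - i by omega] at this
  le_one := fun i j hi hj h => by
    have := G.le_one _ _ (by omega) (by omega) h
    omega
  le_two := fun i j x hi hj h h' => by
    have := G.le_two _ _ x (by omega) (by omega) h' h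
    omega
  le_three := fun i j x y hi hj h h' h'' => by
    have := G.le_three _ _ y x (by omega) (by omega) h'' h' h
    omega
  reach := fun a b => by
    have := (G.reach b a).swap
    exact this

theorem mem_segment (G : LongGeodesic A k P) {i a b : ℕ} (hi : i ≤ k + 2) (hb : b ≤ k + 2)
    (h : P i ∈ Segment P a b) : a ≤ i ∧ i ≤ b := by
  obtain ⟨j, h1, h2, h3⟩ := h
  have := G.inj _ _ (by omega) hi h3
  omega

theorem seg (G : LongGeodesic A k P) {a b : ℕ} (hab : a ≤ b) (hb : b ≤ k + 2) :
    PathIn A (Segment P a b) (b - a) (P a) (P b) := by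
  refine ⟨fun t => P (a + t), ⟨?_, ?_⟩, rfl, ?_, ?_⟩
  · intro i j hi hj h
    have := G.inj _ _ (by omega) (by omega) h
    omega
  · intro i hi
    exact G.arc (a + i) (by omega)
  · simp only
    congr 1
    omega
  · intro i hi
    exact ⟨a + i, by omega, by omega, rfl⟩

/-- Extend a path inside `P lo, …, P hi` by a lower segment `P c, …, P d`. -/
theorem extend (G : LongGeodesic A k P) {lo hi b c d m n : ℕ} {u : V}
    (h : PathIn A (Segment P lo hi) m u (P b)) (ha : A (P b) (P c)) (hcd : c ≤ d) (hd : d < lo)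
    (hlo : lo ≤ hi) (hhi : hi ≤ k + 2) (hn : n = m + (d - c) + 1) :
    PathIn A (Segment P c hi) n u (P d) := by
  subst hn
  refine (h.cat ha (G.seg hcd (by omega)) ?_).mono ?_
  · rintro a ⟨i, h1, h2, rfl⟩ h'
    have := G.mem_segment (by omega) (by omega) h'
    omega
  · rintro a (⟨i, h1, h2, rfl⟩ | ⟨i, h1, h2, rfl⟩)
    · exact ⟨i, by omega, by omega, rfl⟩
    · exact ⟨i, by omega, by omega, rfl⟩

/-- The path `P a, …, P b, P c, …, P d` with `d < a`. -/
theorem seg_two (G : LongGeodesic A k P) {a b c d n : ℕ} (hab : a ≤ b) (hb : b ≤ k + 2)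
    (hbc : A (P b) (P c)) (hcd : c ≤ d) (hda : d < a) (hn : n = (b - a) + (d - c) + 1) :
    PathIn A (Segment P c b) n (P a) (P d) :=
  G.extend (G.seg hab hb) hbc hcd hda hab hb hn

/-- The path `P a, …, P b, P c, …, P d, P e, …, P f` with `f < c` and `d < a`. -/
theorem seg_three (G : LongGeodesic A k P) {a b c d e f n : ℕ} (hab : a ≤ b) (hb : b ≤ k + 2)
    (hbc : A (P b) (P c)) (hcd : c ≤ d) (hda : d < a) (hde : A (P d) (P e)) (hef : e ≤ f)
    (hfc : f < c) (hn : n = (b - a) + (d - c) + (f - e) + 2) :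
    PathIn A (Segment P e b) n (P a) (P f) :=
  G.extend (G.seg_two hab hb hbc hcd hda rfl) hde hef hfc (by omega) hb (by omega)

theorem back_of_path (G : LongGeodesic A k P) {S : Set V} {i j n : ℕ}
    (hp : PathIn A S n (P i) (P j)) (hn : n = k) (hi : i ≤ k + 2) (hij : j + 2 ≤ i) :
    A (P i) (P j) := by
  rcases G.qt.adj hp hn with h | h
  · exact h
  · have := G.le_one _ _ hi (by omega) h
    omega

theorem arc_k (G : LongGeodesic A k P) {j : ℕ} (hj : j ≤ 2) : A (P (k + j)) (P j) := by
  have := G.five_le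
  rcases G.qt.adj (G.seg (show j ≤ k + j by omega) (by omega)) (by omega) with h | h
  · have := G.le_one _ _ (by omega) (by omega) h
    omega
  · exact h

theorem arc_top_zero (G : LongGeodesic A k P) : A (P (k + 2)) (P 0) := by
  have h5 := G.five_le
  have h0 := G.arc_k (j := 0) (by omega)
  exact G.back_of_path (G.seg_three (a := k + 2) (b := k + 2) (c := 2) (d := k) (e := 0) (f := 0)
    le_rfl le_rfl (G.arc_k le_rfl) (by omega) (by omega) h0 le_rfl (by omega) rfl)
    (by omega) le_rfl (by omega)

theorem arc_three (G : LongGeodesic A k P) {j : ℕ} (hj : j + 3 ≤ k + 2) :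
    A (P (j + 3)) (P j) :=
  G.back_of_path (G.seg_two hj le_rfl G.arc_top_zero (Nat.zero_le j) (by omega) rfl)
    (by omega) hj (by omega)

/-- Descent to `P 0` in steps of two. -/
theorem arc_to_zero_of_le (G : LongGeodesic A k P) {b i : ℕ} (hb : 2 ≤ b) (h : A (P b) (P 0))
    (hbi : b ≤ i) (hi : i ≤ k + 2) (hpar : i % 2 = b % 2) : A (P i) (P 0) := by
  induction i using Nat.strong_induction_on with
  | _ i ih =>
    rcases Nat.eq_or_lt_of_le hbi with rfl | hlt
    · exact h
    · have h2 : A (P (i - 2)) (P 0) := ih (i - 2) (by omega) (by omega) (by omega) (by omega)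
      exact G.back_of_path (G.seg_three (a := i) (b := k + 2) (c := 2) (d := i - 2) (e := 0)
        (f := 0) hi le_rfl (G.arc_k le_rfl) (by omega) (by omega) h2 le_rfl (by omega) rfl)
        (by omega) hi (by omega)

theorem arc_odd_zero (G : LongGeodesic A k P) {i : ℕ} (h3 : 3 ≤ i) (hi : i ≤ k + 2)
    (hpar : i % 2 = 1) : A (P i) (P 0) :=
  G.arc_to_zero_of_le (b := 3) (by omega) (G.arc_three (j := 0) (by omega)) h3 hi (by omega)

theorem arc_top_even (G : LongGeodesic A k P) {j : ℕ} (hj : j + 3 ≤ k + 2)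
    (hpar : j % 2 = 0) : A (P (k + 2)) (P j) := by
  have hk := G.odd
  have h := G.rev.arc_odd_zero (i := k + 2 - j) (by omega) (by omega) (by omega)
  simpa [show k + 2 - (k + 2 - j) = j by omega] using h

/-- Every backward pair at odd distance at least three along `P` is an arc. -/
theorem arc_back (G : LongGeodesic A k P) {i j : ℕ} (hij : j + 3 ≤ i) (hi : i ≤ k + 2)
    (hpar : i % 2 ≠ j % 2) : A (P i) (P j) := by
  have hk := G.odd
  rcases Nat.eq_or_lt_of_le hij with rfl | hlt
  · exact G.arc_three hi
  · rcases Nat.mod_two_eq_zero_or_one i with h0 | h1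
    · exact G.back_of_path (G.seg_three (a := i) (b := k + 2) (c := j + 3) (d := i - 1) (e := 0)
        (f := j) hi le_rfl (G.arc_top_even (by omega) (by omega)) (by omega) (by omega)
        (G.arc_odd_zero (by omega) (by omega) (by omega)) (by omega) (by omega) rfl)
        (by omega) hi (by omega)
    · exact G.back_of_path (G.seg_three (a := i) (b := k + 2) (c := j + 2) (d := i - 2) (e := 0)
        (f := j) hi le_rfl (G.arc_top_even (by omega) (by omega)) (by omega) (by omega)
        (G.arc_odd_zero (by omega) (by omega) (by omega)) (by omega) (by omega) rfl)
        (by omega) hi (by omega)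

theorem _root_.OffPath.rev {x : V} (h : OffPath k P x) :
    OffPath k (fun i => P (k + 2 - i)) x :=
  fun i _ => h (k + 2 - i) (by omega)

theorem _root_.OffPath.notMem {x : V} (h : OffPath k P x) {a b : ℕ} (hb : b ≤ k + 2) :
    x ∉ Segment P a b := by
  rintro ⟨i, -, h2, h3⟩
  exact h i (by omega) h3

theorem path_from (G : LongGeodesic A k P) {i m : ℕ} (hi : i ≤ k + 2) (hm : m ≤ k + 2) :
    ∃ j, j ≤ k + 2 ∧ j % 2 = (i + m) % 2 ∧
      PathIn A (Segment P 0 (k + 2)) m (P i) (P j) := by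
  have hk := G.odd
  by_cases h : i + m ≤ k + 2
  · refine ⟨i + m, h, rfl, ?_⟩
    have := G.seg (show i ≤ i + m by omega) h
    rw [show i + m - i = m by omega] at this
    refine this.mono ?_
    rintro a ⟨t, h1, h2, rfl⟩
    exact ⟨t, by omega, by omega, rfl⟩
  · refine ⟨i + m - (k + 3), by omega, by omega, ?_⟩
    exact G.seg_two hi le_rfl G.arc_top_zero (Nat.zero_le _) (by omega) (by omega)

theorem path_to (G : LongGeodesic A k P) {j m : ℕ} (hj : j ≤ k + 2) (hm : m ≤ k + 2) :
    ∃ i, i ≤ k + 2 ∧ i % 2 = (j + m) % 2 ∧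
      PathIn A (Segment P 0 (k + 2)) m (P i) (P j) := by
  have hk := G.odd
  by_cases h : m ≤ j
  · refine ⟨j - m, by omega, by omega, ?_⟩
    have := G.seg (show j - m ≤ j by omega) hj
    rw [show j - (j - m) = m by omega] at this
    refine this.mono ?_
    rintro a ⟨t, h1, h2, rfl⟩
    exact ⟨t, by omega, by omega, rfl⟩
  · refine ⟨j + (k + 3) - m, by omega, by omega, ?_⟩
    exact G.seg_two (by omega) le_rfl G.arc_top_zero (Nat.zero_le _) (by omega) (by omega)

theorem adj_of_out (G : LongGeodesic A k P) {x : V} (hx : OffPath k P x) {i j a b n : ℕ}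
    (h : A x (P i)) (hp : PathIn A (Segment P a b) n (P i) (P j)) (hb : b ≤ k + 2)
    (hn : n + 1 = k) : DAdj A x (P j) :=
  G.qt.adj (hp.cons h (hx.notMem hb)) hn

theorem out_sub_two (G : LongGeodesic A k P) {x : V} (hx : OffPath k P x) {i : ℕ} (h2 : 2 ≤ i)
    (hi : i ≤ k + 2) (h : A x (P i)) : DAdj A x (P (i - 2)) := by
  have h5 := G.five_le
  by_cases hik : i ≤ k
  · exact G.adj_of_out hx h (G.seg_two hik (by omega) (G.arc_k (j := 0) (by omega))
      (Nat.zero_le (i - 2)) (by omega) rfl) (by omega) (by omega)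
  · exact G.adj_of_out hx h (G.seg_two hi le_rfl (G.arc_k (j := 2) le_rfl)
      (show 2 ≤ i - 2 by omega) (by omega) rfl) (by omega) (by omega)

theorem out_sub_four (G : LongGeodesic A k P) {x : V} (hx : OffPath k P x) {i : ℕ} (h4 : 4 ≤ i)
    (hi : i ≤ k + 2) (h : A x (P i)) : A x (P (i - 4)) := by
  rcases G.adj_of_out hx h (G.seg_two hi le_rfl G.arc_top_zero (Nat.zero_le (i - 4)) (by omega)
    rfl) le_rfl (by omega) with h' | h'
  · exact h'
  · have := G.le_two _ _ x hi (by omega) h' h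
    omega

theorem out_add (G : LongGeodesic A k P) {x : V} (hx : OffPath k P x) {i : ℕ} (h3 : i ≤ 3)
    (h : A x (P i)) : DAdj A x (P (i + k - 1)) := by
  have h5 := G.five_le
  exact G.adj_of_out hx h (G.seg (b := i + k - 1) (by omega) (by omega)) (by omega) (by omega)

theorem out_down (G : LongGeodesic A k P) {x : V} (hx : OffPath k P x) {M : ℕ}
    (hM : M ≤ k + 2) (h : A x (P M)) (d : ℕ) :
    ∀ i, i + 4 + 2 * d = M → A x (P i) := by
  induction d with
  | zero =>
    rintro i rfl
    simpa using G.out_sub_four hx (by omega) hM h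
  | succ d ih =>
    intro i hi
    have h' := G.out_sub_two hx (by omega) (by omega) (ih (i + 2) (by omega))
    rw [show i + 2 - 2 = i by omega] at h'
    rcases h' with h' | h'
    · exact h'
    · have := G.le_two _ _ x hM (by omega) h' h
      omega

theorem out_of_out (G : LongGeodesic A k P) {x : V} (hx : OffPath k P x) {M i : ℕ}
    (hM : M ≤ k + 2) (h : A x (P M)) (hi : i + 4 ≤ M) (hpar : i % 2 = M % 2) : A x (P i) :=
  G.out_down hx hM h ((M - i - 4) / 2) i (by omega)

theorem adj_of_out_le (G : LongGeodesic A k P) {x : V} (hx : OffPath k P x) {M i : ℕ}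
    (hM : M ≤ k + 2) (h : A x (P M)) (hi : i ≤ M) (hpar : i % 2 = M % 2) : DAdj A x (P i) := by
  rcases Nat.eq_or_lt_of_le hi with rfl | hlt
  · exact Or.inl h
  · by_cases h2 : i + 2 = M
    · subst h2
      simpa using G.out_sub_two hx (by omega) hM h
    · exact Or.inl (G.out_of_out hx hM h (by omega) hpar)

theorem in_of_in (G : LongGeodesic A k P) {x : V} (hx : OffPath k P x) {M i : ℕ}
    (hi : i ≤ k + 2) (h : A (P M) x) (hM : M + 4 ≤ i) (hpar : i % 2 = M % 2) : A (P i) x := by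
  have := G.rev.out_of_out hx.rev (M := k + 2 - M) (i := k + 2 - i) (by omega)
    (by simpa [show k + 2 - (k + 2 - M) = M by omega] using h) (by omega) (by omega)
  simpa [show k + 2 - (k + 2 - i) = i by omega] using this

theorem adj_of_in_le (G : LongGeodesic A k P) {x : V} (hx : OffPath k P x) {M i : ℕ}
    (hi : i ≤ k + 2) (h : A (P M) x) (hM : M ≤ i) (hpar : i % 2 = M % 2) : DAdj A x (P i) := by
  have := G.rev.adj_of_out_le hx.rev (M := k + 2 - M) (i := k + 2 - i) (by omega)
    (by simpa [show k + 2 - (k + 2 - M) = M by omega] using h) (by omega) (by omega)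
  simp only [show k + 2 - (k + 2 - i) = i by omega] at this
  exact this.symm

end LongGeodesic

/-- `x` sends an arc to some `P i` with `i` of parity `c`. -/
def OutTo (A : V → V → Prop) (k : ℕ) (P : ℕ → V) (x : V) (c : ℕ) : Prop :=
  ∃ i, i ≤ k + 2 ∧ i % 2 = c % 2 ∧ A x (P i)

/-- `x` receives an arc from some `P i` with `i` of parity `c`. -/
def InFrom (A : V → V → Prop) (k : ℕ) (P : ℕ → V) (x : V) (c : ℕ) : Prop :=
  ∃ i, i ≤ k + 2 ∧ i % 2 = c % 2 ∧ A (P i) x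

/-- `x` is adjacent to some `P i` with `i` of parity `c`. -/
def Meets (A : V → V → Prop) (k : ℕ) (P : ℕ → V) (x : V) (c : ℕ) : Prop :=
  OutTo A k P x c ∨ InFrom A k P x c

theorem meets_of_adj {A : V → V → Prop} {k : ℕ} {P : ℕ → V} {x : V} {i c : ℕ}
    (h : DAdj A x (P i)) (hi : i ≤ k + 2) (hc : i % 2 = c % 2) : Meets A k P x c :=
  h.imp (fun h => ⟨i, hi, hc, h⟩) (fun h => ⟨i, hi, hc, h⟩)

theorem OutTo.congr {A : V → V → Prop} {k : ℕ} {P : ℕ → V} {x : V} {c d : ℕ}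
    (h : OutTo A k P x c) (hcd : c % 2 = d % 2) : OutTo A k P x d := by
  obtain ⟨i, h1, h2, h3⟩ := h
  exact ⟨i, h1, by omega, h3⟩

theorem InFrom.congr {A : V → V → Prop} {k : ℕ} {P : ℕ → V} {x : V} {c d : ℕ}
    (h : InFrom A k P x c) (hcd : c % 2 = d % 2) : InFrom A k P x d := by
  obtain ⟨i, h1, h2, h3⟩ := h
  exact ⟨i, h1, by omega, h3⟩

theorem Meets.congr {A : V → V → Prop} {k : ℕ} {P : ℕ → V} {x : V} {c d : ℕ}
    (h : Meets A k P x c) (hcd : c % 2 = d % 2) : Meets A k P x d :=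
  h.imp (·.congr hcd) (·.congr hcd)

namespace LongGeodesic

variable {A : V → V → Prop} {k : ℕ} {P : ℕ → V}

theorem outTo_rev (G : LongGeodesic A k P) {x : V} {c : ℕ} :
    OutTo (fun a b => A b a) k (fun i => P (k + 2 - i)) x (c + 1) ↔ InFrom A k P x c := by
  have hk := G.odd
  constructor
  · rintro ⟨i, h1, h2, h3⟩
    exact ⟨k + 2 - i, by omega, by omega, h3⟩
  · rintro ⟨i, h1, h2, h3⟩
    exact ⟨k + 2 - i, by omega, by omega, by simpa [show k + 2 - (k + 2 - i) = i by omega]⟩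

theorem inFrom_rev (G : LongGeodesic A k P) {x : V} {c : ℕ} :
    InFrom (fun a b => A b a) k (fun i => P (k + 2 - i)) x (c + 1) ↔ OutTo A k P x c := by
  have hk := G.odd
  constructor
  · rintro ⟨i, h1, h2, h3⟩
    exact ⟨k + 2 - i, by omega, by omega, h3⟩
  · rintro ⟨i, h1, h2, h3⟩
    exact ⟨k + 2 - i, by omega, by omega, by simpa [show k + 2 - (k + 2 - i) = i by omega]⟩

theorem meets_rev (G : LongGeodesic A k P) {x : V} {c : ℕ} :
    Meets (fun a b => A b a) k (fun i => P (k + 2 - i)) x (c + 1) ↔ Meets A k P x c := by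
  rw [Meets, Meets, G.outTo_rev, G.inFrom_rev, or_comm]

/-- If `x` sends but does not receive arcs in a parity class, it dominates the whole class. -/
theorem out_full (G : LongGeodesic A k P) {x : V} (hx : OffPath k P x) {c : ℕ}
    (ho : OutTo A k P x c) (hn : ¬ InFrom A k P x c) {j : ℕ} (hj : j ≤ k + 2)
    (hjc : j % 2 = c % 2) : A x (P j) := by
  have hk := G.odd
  have h5 := G.five_le
  have key : ∀ j, j ≤ k + 2 → j % 2 = c % 2 → DAdj A x (P j) → A x (P j) :=
    fun j hj hjc h => h.resolve_right fun h' => hn ⟨j, hj, hjc, h'⟩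
  obtain ⟨i, hi, hic, h⟩ := ho
  have h0 := key (c % 2) (by omega) (by omega) (G.adj_of_out_le hx hi h (by omega) (by omega))
  have h1 := key _ (by omega) (by omega) (G.out_add hx (by omega) h0)
  have h2 := key (c % 2 + 2) (by omega) (by omega)
    (G.adj_of_out_le hx (by omega) h1 (by omega) (by omega))
  have h3 := key _ (by omega) (by omega) (G.out_add hx (by omega) h2)
  exact key j hj hjc (G.adj_of_out_le hx (by omega) h3 (by omega) (by omega))

theorem in_full (G : LongGeodesic A k P) {x : V} (hx : OffPath k P x) {c : ℕ}
    (hn : InFrom A k P x c) (ho : ¬ OutTo A k P x c) {j : ℕ} (hj : j ≤ k + 2)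
    (hjc : j % 2 = c % 2) : A (P j) x := by
  have hk := G.odd
  have := G.rev.out_full hx.rev (G.outTo_rev.2 hn) (fun h => ho (G.inFrom_rev.1 h))
    (j := k + 2 - j) (by omega) (by omega)
  simpa [show k + 2 - (k + 2 - j) = j by omega] using this

/-- Parity propagation backwards along a path off `P`. -/
theorem meets_of_path_out (G : LongGeodesic A k P) {x y : V} {S : Set V} {m c : ℕ}
    (hS : ∀ z ∈ S, OffPath k P z) (hp : PathIn A S m x y) (hy : OutTo A k P y c)
    (hm : m + 1 ≤ k) : Meets A k P x (c + m) := by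
  have hk := G.odd
  obtain ⟨i, hi, hic, h⟩ := hy
  obtain ⟨j, hj, hjc, hq⟩ := G.path_from hi (show k - 1 - m ≤ k + 2 by omega)
  refine meets_of_adj (G.qt.adj (hp.cat h hq fun a ha => (hS a ha).notMem le_rfl) (by omega)) hj
    (by omega)

theorem meets_of_path_in (G : LongGeodesic A k P) {x y : V} {S : Set V} {m c : ℕ}
    (hS : ∀ z ∈ S, OffPath k P z) (hp : PathIn A S m x y) (hx : InFrom A k P x c)
    (hm : m + 1 ≤ k) : Meets A k P y (c + m) := by
  have h := G.rev.meets_of_path_out (fun z hz => (hS z hz).rev) hp.rev (G.outTo_rev.2 hx) hm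
  rw [show c + 1 + m = c + m + 1 by omega] at h
  exact G.meets_rev.1 h

theorem arc_path {x y : V} (hx : OffPath k P x) (hy : OffPath k P y) (hxy : x ≠ y)
    (h : A x y) : PathIn A {z | OffPath k P z} 1 x y :=
  ((PathIn.single (A := A) (Set.mem_singleton y)).cons h hxy).mono (by
    rintro z (rfl | rfl)
    · exact hx
    · exact hy)

theorem meets_of_arc_out (G : LongGeodesic A k P) {x y : V} {c : ℕ} (hx : OffPath k P x)
    (hy : OffPath k P y) (hxy : x ≠ y) (h : A x y) (ho : OutTo A k P y c) :
    Meets A k P x (c + 1) :=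
  G.meets_of_path_out (fun _ hz => hz) (arc_path hx hy hxy h) ho (by have := G.five_le; omega)

theorem meets_of_arc_in (G : LongGeodesic A k P) {x y : V} {c : ℕ} (hx : OffPath k P x)
    (hy : OffPath k P y) (hxy : x ≠ y) (h : A x y) (hn : InFrom A k P x c) :
    Meets A k P y (c + 1) :=
  G.meets_of_path_in (fun _ hz => hz) (arc_path hx hy hxy h) hn (by have := G.five_le; omega)

/-- There is no arc from a vertex that sends nothing to `P` to a vertex that receives nothing. -/
theorem no_arc_sink_source (G : LongGeodesic A k P) {w z : V} (hw : OffPath k P w)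
    (hz : OffPath k P z) {c d : ℕ} (hwn : InFrom A k P w c) (hwo : ¬ OutTo A k P w c)
    (hzo : OutTo A k P z d) (hzn : ¬ InFrom A k P z d) : ¬ A w z := by
  intro h
  have hk := G.odd
  have h5 := G.five_le
  have h1 := G.in_full hw hwn hwo (j := c % 2) (by omega) (by omega)
  have h2 := G.out_full hz hzo hzn (j := k + 1 + (d + 1 + 1) % 2) (by omega) (by omega)
  have := G.le_three _ _ w z (by omega) (by omega) h1 h h2
  omega

/-- `ρ` measures the distance, through vertices off `P`, to a vertex sending an arc to `P`. -/
structure _root_.IsRank (A : V → V → Prop) (k : ℕ) (P : ℕ → V) (ρ : V → ℕ) : Prop where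
  zero_iff : ∀ x, OffPath k P x → (ρ x = 0 ↔ ∃ c, OutTo A k P x c)
  exists_succ : ∀ x, OffPath k P x → 0 < ρ x → ∃ y, OffPath k P y ∧ A x y ∧ ρ y + 1 = ρ x
  le_succ : ∀ x y, OffPath k P x → OffPath k P y → A x y → ρ x ≤ ρ y + 1

/-- Some vertex sending an arc to `P` is reached from `x` by a walk of length `n` off `P`. -/
def ReachesIn (A : V → V → Prop) (k : ℕ) (P : ℕ → V) : ℕ → V → Prop
  | 0, x => OffPath k P x ∧ ∃ c, OutTo A k P x c
  | n + 1, x => OffPath k P x ∧ ∃ y, A x y ∧ ReachesIn A k P n y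

theorem ReachesIn.offPath : ∀ {n : ℕ} {x : V}, ReachesIn A k P n x → OffPath k P x
  | 0, _, h => h.1
  | _ + 1, _, h => h.1

theorem exists_reachesIn (G : LongGeodesic A k P) {x : V} (hx : OffPath k P x) :
    ∃ n, ReachesIn A k P n x := by
  have h := G.reach x (P 0)
  induction h using Relation.ReflTransGen.head_induction_on with
  | refl => exact absurd rfl (hx 0 (by omega))
  | head hab _ ih =>
    rename_i a b _
    by_cases hb : OffPath k P b
    · obtain ⟨n, hn⟩ := ih hb
      exact ⟨n + 1, hx, b, hab, hn⟩
    · unfold OffPath at hb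
      push Not at hb
      obtain ⟨i, hi, rfl⟩ := hb
      exact ⟨0, hx, i, i, hi, rfl, hab⟩

theorem exists_rank (G : LongGeodesic A k P) : ∃ ρ : V → ℕ, IsRank A k P ρ := by
  have hmem : ∀ x, OffPath k P x → ReachesIn A k P (sInf {n | ReachesIn A k P n x}) x :=
    fun x hx => Nat.sInf_mem (G.exists_reachesIn hx)
  refine ⟨fun x => sInf {n | ReachesIn A k P n x}, ⟨?_, ?_, ?_⟩⟩
  · intro x hx
    refine ⟨fun h0 => ?_, fun h => Nat.sInf_eq_zero.2 (Or.inl ⟨hx, h⟩)⟩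
    have := hmem x hx
    rw [h0] at this
    exact this.2
  · intro x hx hpos
    have h := hmem x hx
    obtain ⟨n, hn⟩ : ∃ n, sInf {n | ReachesIn A k P n x} = n + 1 :=
      ⟨_, (Nat.succ_pred hpos.ne').symm⟩
    rw [hn] at h
    obtain ⟨-, y, hxy, hy⟩ := h
    refine ⟨y, hy.offPath, hxy, ?_⟩
    have h1 : sInf {n | ReachesIn A k P n y} ≤ n := Nat.sInf_le hy
    have h2 : sInf {n | ReachesIn A k P n x} ≤ sInf {n | ReachesIn A k P n y} + 1 :=
      Nat.sInf_le ⟨hx, y, hxy, hmem y hy.offPath⟩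
    omega
  · intro x y hx hy hxy
    exact Nat.sInf_le ⟨hx, y, hxy, hmem y hy⟩

theorem _root_.IsRank.exists_path {ρ : V → ℕ} (R : IsRank A k P ρ) {x : V}
    (hx : OffPath k P x) (m : ℕ) (hm : m ≤ ρ x) :
    ∃ y, OffPath k P y ∧ ρ y + m = ρ x ∧
      PathIn A {w | OffPath k P w ∧ (w = y ∨ ρ y < ρ w) ∧ (w = x ∨ ρ w < ρ x)} m x y := by
  induction m with
  | zero => exact ⟨x, hx, rfl, PathIn.single ⟨hx, Or.inl rfl, Or.inl rfl⟩⟩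
  | succ m ih =>
    obtain ⟨y, hy, hyx, hp⟩ := ih (by omega)
    obtain ⟨z, hz, hyz, hzy⟩ := R.exists_succ y hy (by omega)
    refine ⟨z, hz, by omega, (hp.snoc hyz ?_).mono ?_⟩
    · rintro ⟨-, rfl | h, -⟩ <;> omega
    · rintro w (⟨h1, h2, h3⟩ | rfl)
      · refine ⟨h1, Or.inr ?_, h3⟩
        rcases h2 with rfl | h2 <;> omega
      · exact ⟨hz, Or.inl rfl, Or.inr (by omega)⟩

/-- Every vertex off `P` is adjacent to a vertex of `P`. -/
theorem exists_meets (G : LongGeodesic A k P) {x : V} (hx : OffPath k P x) :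
    ∃ c, Meets A k P x c := by
  have h5 := G.five_le
  obtain ⟨ρ, R⟩ := G.exists_rank
  induction hs : ρ x using Nat.strong_induction_on generalizing x with
  | _ s ih =>
    subst hs
    by_cases hlt : ρ x + 1 ≤ k
    · obtain ⟨y, hy, hyx, hp⟩ := R.exists_path hx (ρ x) le_rfl
      obtain ⟨c, hc⟩ := (R.zero_iff y hy).1 (by omega)
      exact ⟨_, G.meets_of_path_out (fun z hz => hz.1) hp hc hlt⟩
    · obtain ⟨y, hy, hyx, hp⟩ := R.exists_path hx (k - 1) (by omega)
      obtain ⟨z, hz, hyz, hzy⟩ := R.exists_succ y hy (by omega)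
      have hxz : x ≠ z := by rintro rfl; omega
      have hp' := hp.snoc hyz (by rintro ⟨-, rfl | h, -⟩ <;> omega)
      rcases G.qt.adj hp' (by omega) with h | h
      · have := R.le_succ x z hx hz h
        omega
      · by_cases hn : ∃ c, InFrom A k P z c
        · obtain ⟨c, hc⟩ := hn
          exact ⟨_, G.meets_of_arc_in hz hx hxz.symm h hc⟩
        · exfalso
          push Not at hn
          obtain ⟨d, hd⟩ := ih (ρ z) (by omega) hz rfl
          have hzo := hd.resolve_right (hn d)
          have hz0 := (R.zero_iff z hz).2 ⟨d, hzo⟩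
          have hyo : ∀ c, ¬ OutTo A k P y c := fun c hc => by
            have := (R.zero_iff y hy).2 ⟨c, hc⟩
            omega
          obtain ⟨c, hc⟩ := ih (ρ y) (by omega) hy rfl
          exact G.no_arc_sink_source hy hz (hc.resolve_left (hyo c)) (hyo c) hzo (hn d) hyz

theorem low_of_outTo (G : LongGeodesic A k P) {x : V} (hx : OffPath k P x) {c : ℕ} (hc : c ≤ 1)
    (h : OutTo A k P x c) : A x (P c) ∨ (A (P c) x ∧ A x (P (c + 2))) := by
  obtain ⟨i, hi, hic, h⟩ := h
  rcases G.adj_of_out_le hx hi h (show c ≤ i by omega) (by omega) with h' | h'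
  · exact Or.inl h'
  · have := G.le_two _ _ x hi (by omega) h' h
    obtain rfl | rfl : i = c ∨ i = c + 2 := by omega
    · exact Or.inl h
    · exact Or.inr ⟨h', h⟩

theorem high_of_inFrom (G : LongGeodesic A k P) {x : V} (hx : OffPath k P x) {t : ℕ}
    (ht : k + 1 ≤ t) (ht' : t ≤ k + 2) (h : InFrom A k P x t) :
    A (P t) x ∨ (A x (P t) ∧ A (P (t - 2)) x) := by
  obtain ⟨j, hj, hjt, h⟩ := h
  rcases G.adj_of_in_le hx ht' h (show j ≤ t by omega) (by omega) with htop | htop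
  · have := G.le_two _ _ x ht' hj h htop
    obtain rfl | rfl : j = t ∨ j = t - 2 := by omega
    · exact Or.inl h
    · exact Or.inr ⟨htop, h⟩
  · exact Or.inl htop

/-- Two vertices with arcs in both directions to classes of opposite parity are joined through a
segment of `P` of length `k - 2`. -/
theorem exists_link_zero (G : LongGeodesic A k P) {x y : V} (hx : OffPath k P x)
    (hy : OffPath k P y) (hxo : OutTo A k P x 0) (hxn : InFrom A k P x 0)
    (hyo : OutTo A k P y 1) (hyn : InFrom A k P y 1) :
    ∃ i, i ≤ 4 ∧ ((A x (P i) ∧ A (P (i + k - 2)) y) ∨ (A y (P i) ∧ A (P (i + k - 2)) x)) := by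
  have hk := G.odd
  have h5 := G.five_le
  by_contra! hcon
  have hxy : ∀ i, i ≤ 4 → A x (P i) → ¬ A (P (i + k - 2)) y := fun i hi => (hcon i hi).1
  have hyx : ∀ i, i ≤ 4 → A y (P i) → ¬ A (P (i + k - 2)) x := fun i hi => (hcon i hi).2
  have hx0 := G.low_of_outTo hx (by omega) hxo
  have hy1 := G.low_of_outTo hy le_rfl hyo
  have hxk := G.high_of_inFrom hx (t := k + 1) le_rfl (by omega) (hxn.congr (by omega))
  have hyk := G.high_of_inFrom hy (t := k + 2) (by omega) le_rfl (hyn.congr (by omega))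
  have hy1' := hyx 1 (by omega)
  have hy3' := hyx 3 (by omega)
  have hx2' := hxy 2 (by omega)
  have hx4' := hxy 4 (by omega)
  rw [show 1 + k - 2 = k - 1 by omega] at hy1'
  rw [show 3 + k - 2 = k + 1 by omega] at hy3'
  rw [show 2 + k - 2 = k by omega] at hx2'
  rw [show 4 + k - 2 = k + 2 by omega] at hx4'
  rw [show k + 1 - 2 = k - 1 by omega] at hxk
  rw [show k + 2 - 2 = k by omega] at hyk
  rcases hx0 with hx0 | ⟨hx0, hx2⟩
  · have hadj := G.out_add hx (i := 0) (by omega) hx0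
    rw [show 0 + k - 1 = k - 1 by omega] at hadj
    by_cases hn : A (P (k - 1)) x
    · have hy1 := hy1.resolve_left fun h => hy1' h hn
      have hyk' : A (P (k + 2)) y := G.in_of_in hy le_rfl hy1.1 (by omega) (by omega)
      have hyk'' : A (P k) y := G.in_of_in hy (by omega) hy1.1 (by omega) (by omega)
      have hxk := hxk.resolve_left (hy3' hy1.2)
      exact hx2' (G.out_of_out hx (by omega) hxk.1 (by omega) (by omega)) hyk''
    · have ho := hadj.resolve_right hn
      have hxk := hxk.resolve_right fun h => hn h.2
      have hy3 : ¬ A y (P 3) := fun h => hy3' h hxk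
      have hy1 := hy1.resolve_right fun h => hy3 h.2
      have hadj' := G.out_add hy (i := 1) (by omega) hy1
      rw [show 1 + k - 1 = k by omega] at hadj'
      rcases Nat.eq_or_lt_of_le h5 with rfl | hlt
      · have hy7 := (hyk.resolve_left (hx4' ho)).1
        exact hy3 (G.out_of_out hy le_rfl hy7 (by omega) (by omega))
      · have hx2 : A x (P 2) := G.out_of_out hx (by omega) ho (by omega) (by omega)
        exact hy3 (G.out_of_out hy (by omega) (hadj'.resolve_right (hx2' hx2)) (by omega)
          (by omega))
  · have h1 : A (P (k - 1)) x := G.in_of_in hx (by omega) hx0 (by omega) (by omega)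
    have h2 : A (P (k + 1)) x := G.in_of_in hx (by omega) hx0 (by omega) (by omega)
    rcases hy1 with h | h
    · exact hy1' h h1
    · exact hy3' h.2 h2

theorem exists_link (G : LongGeodesic A k P) {x y : V} {c : ℕ} (hx : OffPath k P x)
    (hy : OffPath k P y) (hxo : OutTo A k P x c) (hxn : InFrom A k P x c)
    (hyo : OutTo A k P y (c + 1)) (hyn : InFrom A k P y (c + 1)) :
    ∃ i, i ≤ 4 ∧ ((A x (P i) ∧ A (P (i + k - 2)) y) ∨ (A y (P i) ∧ A (P (i + k - 2)) x)) := by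
  rcases Nat.mod_two_eq_zero_or_one c with h | h
  · exact G.exists_link_zero hx hy (hxo.congr (by omega)) (hxn.congr (by omega))
      (hyo.congr (by omega)) (hyn.congr (by omega))
  · obtain ⟨i, hi, h'⟩ := G.exists_link_zero hy hx (hyo.congr (by omega)) (hyn.congr (by omega))
      (hxo.congr (by omega)) (hxn.congr (by omega))
    exact ⟨i, hi, h'.symm⟩

theorem adj_of_link (G : LongGeodesic A k P) {x y : V} (hx : OffPath k P x)
    (hy : OffPath k P y) (hxy : x ≠ y) {i j : ℕ} (hi : A x (P i)) (hj : A (P j) y)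
    (hp : PathIn A (Segment P 0 (k + 2)) (k - 2) (P i) (P j)) : DAdj A x y := by
  have h5 := G.five_le
  refine G.qt.adj ((hp.cons hi (hx.notMem le_rfl)).snoc hj ?_) (by omega)
  rintro (h | h)
  · exact hxy h.symm
  · exact hy.notMem le_rfl h

theorem adj_of_mixed (G : LongGeodesic A k P) {x y : V} {c : ℕ} (hx : OffPath k P x)
    (hy : OffPath k P y) (hxy : x ≠ y) (hxo : OutTo A k P x c) (hxn : InFrom A k P x c)
    (hyo : OutTo A k P y (c + 1)) (hyn : InFrom A k P y (c + 1)) : DAdj A x y := by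
  have h5 := G.five_le
  obtain ⟨i, hi, h⟩ := G.exists_link hx hy hxo hxn hyo hyn
  have hp : PathIn A (Segment P 0 (k + 2)) (k - 2) (P i) (P (i + k - 2)) := by
    have := G.seg (show i ≤ i + k - 2 by omega) (by omega)
    rw [show i + k - 2 - i = k - 2 by omega] at this
    refine this.mono ?_
    rintro a ⟨t, h1, h2, rfl⟩
    exact ⟨t, by omega, by omega, rfl⟩
  rcases h with h | h
  · exact G.adj_of_link hx hy hxy h.1 h.2 hp
  · exact (G.adj_of_link hy hx hxy.symm h.1 h.2 hp).symm

theorem adj_of_out_full (G : LongGeodesic A k P) {x y : V} {c : ℕ} (hx : OffPath k P x)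
    (hy : OffPath k P y) (hxy : x ≠ y) (hxo : OutTo A k P x c) (hxn : ¬ InFrom A k P x c)
    (hyn : InFrom A k P y (c + 1)) : DAdj A x y := by
  have hk := G.odd
  obtain ⟨j, hj, hjc, h⟩ := hyn
  obtain ⟨i, hi, hic, hp⟩ := G.path_to hj (show k - 2 ≤ k + 2 by omega)
  exact G.adj_of_link hx hy hxy (G.out_full hx hxo hxn hi (by have := G.five_le; omega)) h hp

theorem adj_of_in_full (G : LongGeodesic A k P) {x y : V} {c : ℕ} (hx : OffPath k P x)
    (hy : OffPath k P y) (hxy : x ≠ y) (hxo : OutTo A k P x c)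
    (hyn : InFrom A k P y (c + 1)) (hyo : ¬ OutTo A k P y (c + 1)) : DAdj A x y := by
  have hk := G.odd
  obtain ⟨i, hi, hic, h⟩ := hxo
  obtain ⟨j, hj, hjc, hp⟩ := G.path_from hi (show k - 2 ≤ k + 2 by omega)
  exact G.adj_of_link hx hy hxy h (G.in_full hy hyn hyo hj (by have := G.five_le; omega)) hp

theorem high_chord (G : LongGeodesic A k P) (h : A (P (k - 1)) (P 0)) :
    A (P (k + 2)) (P 3) := by
  have hk := G.odd
  have h5 := G.five_le
  exact G.back_of_path (G.seg_three (a := k + 2) (b := k + 2) (c := 4) (d := k - 1) (e := 0)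
    (f := 3) le_rfl le_rfl (G.arc_back (by omega) le_rfl (by omega)) (by omega) (by omega) h
    (by omega) (by omega) rfl) (by omega) le_rfl (by omega)

theorem low_chord (G : LongGeodesic A k P) (h : A (P (k + 2)) (P 3)) :
    A (P (k - 1)) (P 0) := by
  have h5 := G.five_le
  have := G.rev.high_chord (by simpa [show k + 2 - (k - 1) = 3 by omega] using h)
  simpa [show k + 2 - 3 = k - 1 by omega] using this

theorem adj_pred_of_out (G : LongGeodesic A k P) (hE : A (P (k - 1)) (P 0)) {x : V}
    (hx : OffPath k P x) {i : ℕ} (hi : i + 1 ≤ k - 1) (h : A x (P (i + 1))) :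
    DAdj A x (P i) :=
  G.adj_of_out hx h (G.seg_two hi (by omega) hE (Nat.zero_le i) (by omega) rfl) (by omega)
    (by omega)

theorem adj_succ_of_in (G : LongGeodesic A k P) (hE : A (P (k + 2)) (P 3)) {x : V}
    (hx : OffPath k P x) {j : ℕ} (hj : 3 ≤ j) (hj' : j ≤ k + 1) (h : A (P j) x) :
    DAdj A x (P (j + 1)) := by
  have h5 := G.five_le
  have := G.rev.adj_pred_of_out (by simpa [show k + 2 - (k - 1) = 3 by omega] using hE) hx.rev
    (i := k + 1 - j) (by omega) (by simpa [show k + 2 - (k + 1 - j + 1) = j by omega] using h)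
  simp only [show k + 2 - (k + 1 - j) = j + 1 by omega] at this
  exact this.symm

theorem meets_of_adj_adj {x : V} {i j c : ℕ} (hi : DAdj A x (P i)) (hj : DAdj A x (P j))
    (hik : i ≤ k + 2) (hjk : j ≤ k + 2) (hij : i % 2 ≠ j % 2) : Meets A k P x c := by
  by_cases h : i % 2 = c % 2
  · exact meets_of_adj hi hik h
  · exact meets_of_adj hj hjk (by omega)

theorem meets_of_chord_of_out (G : LongGeodesic A k P) (hE : A (P (k - 1)) (P 0)) {x : V}
    (hx : OffPath k P x) {d : ℕ} (h : OutTo A k P x d) (c : ℕ) : Meets A k P x c := by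
  have hk := G.odd
  have h5 := G.five_le
  have key : ∀ i, i + 1 ≤ k - 1 → A x (P (i + 1)) → Meets A k P x c := fun i hi h =>
    meets_of_adj_adj (Or.inl h) (G.adj_pred_of_out hE hx hi h) (by omega) (by omega) (by omega)
  rcases Nat.mod_two_eq_zero_or_one d with hd | hd
  · rcases G.low_of_outTo hx (Nat.zero_le 1) (h.congr (by omega)) with h0 | h0
    · have h1 := G.out_add hx (by omega) h0
      rw [show 0 + k - 1 = k - 2 + 1 by omega] at h1
      rcases h1 with h1 | h1
      · exact key _ (by omega) h1
      · exact meets_of_adj_adj (Or.inl h0)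
          (G.adj_succ_of_in (G.high_chord hE) hx (by omega) (by omega) h1)
          (by omega) (by omega) (by omega)
    · exact key 1 (by omega) h0.2
  · rcases G.low_of_outTo hx (c := 1) le_rfl (h.congr (by omega)) with h0 | h0
    · exact key 0 (by omega) h0
    · exact key 2 (by omega) h0.2

theorem meets_of_chord (G : LongGeodesic A k P) (hE : A (P (k - 1)) (P 0)) {x : V}
    (hx : OffPath k P x) (c : ℕ) : Meets A k P x c := by
  have h5 := G.five_le
  obtain ⟨d, h | h⟩ := G.exists_meets hx
  · exact G.meets_of_chord_of_out hE hx h c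
  · refine G.meets_rev.1 (G.rev.meets_of_chord_of_out ?_ hx.rev (G.outTo_rev.2 h) (c + 1))
    simpa [show k + 2 - (k - 1) = 3 by omega] using G.high_chord hE

/-- The path `P a, …, P b, x, P c, …, P d` for two disjoint segments. -/
theorem seg_vertex_seg (G : LongGeodesic A k P) {x : V} (hx : OffPath k P x) {a b c d : ℕ}
    (hab : a ≤ b) (hb : b ≤ k + 2) (hcd : c ≤ d) (hd : d ≤ k + 2) (hbx : A (P b) x)
    (hxc : A x (P c)) (hdisj : b < c ∨ d < a) :
    PathIn A (Segment P a b ∪ {x} ∪ Segment P c d) (b - a + 1 + (d - c) + 1) (P a) (P d) := by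
  refine ((G.seg hab hb).snoc hbx (hx.notMem hb)).cat hxc (G.seg hcd hd) ?_
  rintro w (⟨t, h1, h2, rfl⟩ | rfl)
  · intro h
    have := G.mem_segment (by omega) hd h
    omega
  · exact hx.notMem hd

theorem chord_of_link (G : LongGeodesic A k P) {x : V} (hx : OffPath k P x) {i : ℕ}
    (hi : i ≤ 4) (ho : A x (P i)) (hn : A (P (i + k - 2)) x) : A (P (k - 1)) (P 0) := by
  have hk := G.odd
  have h5 := G.five_le
  have hmem : ∀ j a b c d, j ≤ k + 2 → b ≤ k + 2 → d ≤ k + 2 → (j < a ∨ b < j) →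
      (j < c ∨ d < j) → P j ∉ Segment P a b ∪ {x} ∪ Segment P c d := by
    rintro j a b c d hj hb hd h1 h2 ((h | h) | h)
    · have := G.mem_segment hj hb h
      omega
    · exact hx j hj h
    · have := G.mem_segment hj hd h
      omega
  rcases Nat.eq_zero_or_pos i with rfl | hpos
  · rw [show 0 + k - 2 = k - 2 by omega] at hn
    exact G.back_of_path ((G.seg_vertex_seg hx (a := 1) (d := 0) (by omega) (by omega) le_rfl
      (by omega) hn ho (by omega)).cons (G.arc_back (i := k - 1) (by omega) (by omega) (by omega))
      (hmem _ _ _ _ _ (by omega) (by omega) (by omega) (by omega) (by omega)))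
      (by omega) (by omega) (by omega)
  · rcases Nat.eq_or_lt_of_le hi with rfl | hlt
    · rw [show 4 + k - 2 = k + 2 by omega] at hn
      exact G.low_chord (G.back_of_path ((G.seg_vertex_seg hx (a := k + 2) (d := k + 1) le_rfl
        (by omega) (by omega) (by omega) hn ho (by omega)).snoc
        (G.arc_back (j := 3) (by omega) (by omega) (by omega))
        (hmem _ _ _ _ _ (by omega) (by omega) (by omega) (by omega) (by omega)))
        (by omega) (by omega) (by omega))
    · exact G.back_of_path ((G.seg_vertex_seg hx (a := k - 1) (d := k - 2) (by omega)
        (by omega) (by omega) (by omega) hn ho (by omega)).snoc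
        (G.arc_back (j := 0) (by omega) (by omega) (by omega))
        (hmem _ _ _ _ _ (by omega) (by omega) (by omega) (by omega) (by omega)))
        (by omega) (by omega) (by omega)

theorem not_out_full_and_in_full (G : LongGeodesic A k P) {x : V} (hx : OffPath k P x) {c d : ℕ}
    (hco : OutTo A k P x c) (hcn : ¬ InFrom A k P x c) (hdn : InFrom A k P x d)
    (hdo : ¬ OutTo A k P x d) : False := by
  have hk := G.odd
  have h5 := G.five_le
  have h1 := G.in_full hx hdn hdo (j := d % 2) (by omega) (by omega)
  have h2 := G.out_full hx hco hcn (j := k + 1 + c % 2) (by omega) (by omega)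
  have := G.le_two _ _ x (by omega) (by omega) h1 h2
  omega

theorem chord_of_out_in (G : LongGeodesic A k P) {x : V} (hx : OffPath k P x)
    (hm : ∀ c, Meets A k P x c) {a b : ℕ} (ha : OutTo A k P x a) (hb : InFrom A k P x b) :
    A (P (k - 1)) (P 0) := by
  have hk := G.odd
  have h5 := G.five_le
  obtain ⟨c, hco, hcn⟩ : ∃ c, OutTo A k P x c ∧ InFrom A k P x c := by
    by_contra! h
    exact G.not_out_full_and_in_full hx ha (h a ha) hb fun h' => h b h' hb
  by_cases ho : OutTo A k P x (c + 1)
  · by_cases hn : InFrom A k P x (c + 1)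
    · obtain ⟨i, hi, h | h⟩ := G.exists_link hx hx hco hcn ho hn
      · exact G.chord_of_link hx hi h.1 h.2
      · exact G.chord_of_link hx hi h.1 h.2
    · obtain ⟨j, hj, hjc, h⟩ := hcn
      have h1 := G.out_full hx ho hn (j := k + 1 + (c + 1) % 2) (by omega) (by omega)
      have := G.le_two _ _ x (by omega) hj h h1
      refine G.chord_of_link hx (i := j + 2 - k) (by omega)
        (G.out_full hx ho hn (by omega) (by omega)) ?_
      rwa [show j + 2 - k + k - 2 = j by omega]
  · have hn := (hm (c + 1)).resolve_left ho
    obtain ⟨i, hi, hic, h⟩ := hco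
    have h1 := G.in_full hx hn ho (j := (c + 1) % 2) (by omega) (by omega)
    have := G.le_two _ _ x hi (by omega) h1 h
    exact G.chord_of_link hx (by omega) h (G.in_full hx hn ho (by omega) (by omega))

theorem chord_of_meets_of_in (G : LongGeodesic A k P) {x : V} (hx : OffPath k P x)
    (hm : ∀ c, Meets A k P x c) {b : ℕ} (hb : InFrom A k P x b) : A (P (k - 1)) (P 0) := by
  obtain ⟨ρ, R⟩ := G.exists_rank
  induction hs : ρ x generalizing x b with
  | zero =>
    obtain ⟨a, ha⟩ := (R.zero_iff x hx).1 hs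
    exact G.chord_of_out_in hx hm ha hb
  | succ s ih =>
    have hxo : ∀ c, ¬ OutTo A k P x c := fun c hc => by
      have := (R.zero_iff x hx).2 ⟨c, hc⟩
      omega
    have hxn : ∀ c, InFrom A k P x c := fun c => (hm c).resolve_left (hxo c)
    obtain ⟨z, hz, hxz, hzx⟩ := R.exists_succ x hx (by omega)
    have hne : x ≠ z := by rintro rfl; omega
    have hmz : ∀ c, Meets A k P z c := fun c =>
      (G.meets_of_arc_in hx hz hne hxz (hxn (c + 1))).congr (by omega)
    by_cases hzn : InFrom A k P z 0
    · exact ih hz hmz hzn (by omega)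
    · exact absurd hxz (G.no_arc_sink_source hx hz hb (hxo b) ((hmz 0).resolve_right hzn) hzn)

/-- A vertex adjacent to both parity classes of `P` forces a chord of `P`. -/
theorem chord_of_meets (G : LongGeodesic A k P) {x : V} (hx : OffPath k P x)
    (hm : ∀ c, Meets A k P x c) : A (P (k - 1)) (P 0) := by
  have h5 := G.five_le
  rcases hm 0 with h | h
  · have hm' : ∀ c, Meets (fun a b => A b a) k (fun i => P (k + 2 - i)) x c := fun c =>
      (G.meets_rev.2 (hm (c + 1))).congr (by omega)
    have := G.rev.chord_of_meets_of_in hx.rev hm' (G.inFrom_rev.2 h)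
    exact G.low_chord (by simpa [show k + 2 - (k - 1) = 3 by omega] using this)
  · exact G.chord_of_meets_of_in hx hm h

/-- If one vertex off `P` is adjacent to both parity classes, then so is every other one. -/
theorem meets_of_meets (G : LongGeodesic A k P) {x y : V} (hx : OffPath k P x)
    (hy : OffPath k P y) {c : ℕ} (h : Meets A k P x c) (h' : Meets A k P x (c + 1)) (d : ℕ) :
    Meets A k P y d := by
  refine G.meets_of_chord (G.chord_of_meets hx fun e => ?_) hy d
  by_cases he : e % 2 = c % 2
  · exact h.congr he.symm
  · exact h'.congr (by omega)

theorem adj_of_mixed_of_meets (G : LongGeodesic A k P) {x y : V} {c : ℕ} (hx : OffPath k P x)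
    (hy : OffPath k P y) (hxy : x ≠ y) (hxo : OutTo A k P x c) (hxn : InFrom A k P x c)
    (hm : Meets A k P y (c + 1)) : DAdj A x y := by
  by_cases ho : OutTo A k P y (c + 1)
  · by_cases hn : InFrom A k P y (c + 1)
    · exact G.adj_of_mixed hx hy hxy hxo hxn ho hn
    · exact (G.adj_of_out_full hy hx hxy.symm ho hn (hxn.congr (by omega))).symm
  · exact G.adj_of_in_full hx hy hxy hxo (hm.resolve_left ho) ho

theorem adj_of_out_in (G : LongGeodesic A k P) {x y : V} {a b c : ℕ} (hx : OffPath k P x)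
    (hy : OffPath k P y) (hxy : x ≠ y) (hxo : OutTo A k P x a) (hxn : InFrom A k P x b)
    (hmx : Meets A k P x c) (hmy : Meets A k P y (c + 1)) : DAdj A x y := by
  obtain ⟨d, hdo, hdn⟩ : ∃ d, OutTo A k P x d ∧ InFrom A k P x d := by
    by_contra! h
    exact G.not_out_full_and_in_full hx hxo (h a hxo) hxn fun h' => h b h' hxn
  by_cases hd : d % 2 = c % 2
  · exact G.adj_of_mixed_of_meets hx hy hxy hdo hdn (hmy.congr (by omega))
  · have hmx' : Meets A k P x (c + 1) := Or.inl (hdo.congr (by omega))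
    exact G.adj_of_mixed_of_meets hx hy hxy hdo hdn (G.meets_of_meets hx hy hmx hmx' _)

theorem adj_of_no_out_of_out (G : LongGeodesic A k P) {x y : V} {a c : ℕ} (hx : OffPath k P x)
    (hy : OffPath k P y) (hxy : x ≠ y) (hxo : ∀ c, ¬ OutTo A k P x c) (hyo : OutTo A k P y a)
    (hmx : Meets A k P x c) (hmy : Meets A k P y (c + 1)) : DAdj A x y := by
  by_cases hyn : ∃ b, InFrom A k P y b
  · obtain ⟨b, hb⟩ := hyn
    exact (G.adj_of_out_in hy hx hxy.symm hyo hb hmy (hmx.congr (by omega))).symm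
  · push Not at hyn
    exact (G.adj_of_out_full hy hx hxy.symm (hmy.resolve_right (hyn _)) (hyn _)
      ((hmx.resolve_left (hxo c)).congr (by omega))).symm

theorem adj_of_no_out_of_le (G : LongGeodesic A k P) {ρ : V → ℕ} (R : IsRank A k P ρ)
    {x y : V} {c : ℕ} (hx : OffPath k P x) (hy : OffPath k P y) (hxy : x ≠ y)
    (hxo : ∀ c, ¬ OutTo A k P x c) (hyo : ∀ c, ¬ OutTo A k P y c)
    (hmx : Meets A k P x c) (hmy : Meets A k P y (c + 1)) (hle : ρ y ≤ ρ x) : DAdj A x y := by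
  have hk := G.odd
  have h5 := G.five_le
  induction hs : ρ y using Nat.strong_induction_on generalizing y with
  | _ s ih =>
    subst hs
    have hyn := hmy.resolve_left (hyo _)
    have hnot : ∀ z, x ∉ {w | OffPath k P w ∧ (w = z ∨ ρ z < ρ w) ∧ (w = y ∨ ρ w < ρ y)} := by
      rintro z ⟨-, -, h | h⟩
      · exact hxy h
      · omega
    by_cases hlt : ρ y ≤ k - 2
    · obtain ⟨z, hz, hzy, hp⟩ := R.exists_path hy (ρ y) le_rfl
      obtain ⟨e, i, hi, hie, h⟩ := (R.zero_iff z hz).1 (by omega)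
      obtain ⟨j, hj, hji, hq⟩ := G.path_from hi (show k - 2 - ρ y ≤ k + 2 by omega)
      have hmx' : Meets A k P x j := by
        by_cases hjc : j % 2 = c % 2
        · exact hmx.congr hjc.symm
        · have h1 := G.meets_of_path_in (fun w hw => hw.1) hp hyn (by omega)
          have h2 : Meets A k P z (c + 1 + ρ y + 1) :=
            meets_of_adj (Or.inl h) hi (by omega)
          exact G.meets_of_meets hz hx h1 h2 j
      have hjx := G.in_full hx (hmx'.resolve_left (hxo j)) (hxo j) hj rfl
      refine (G.qt.adj ((hp.cat h hq fun a ha => ha.1.notMem le_rfl).snoc hjx ?_)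
        (by omega)).symm
      rintro (h' | h')
      · exact hnot z h'
      · exact hx.notMem le_rfl h'
    · obtain ⟨z, hz, hzy, hp⟩ := R.exists_path hy (k - 1) (by omega)
      have hmz : Meets A k P z (c + 1) :=
        (G.meets_of_path_in (fun w hw => hw.1) hp hyn (by omega)).congr (by omega)
      have hxz : x ≠ z := by rintro rfl; omega
      have hadj : DAdj A x z := by
        by_cases hzo : ∃ a, OutTo A k P z a
        · obtain ⟨a, ha⟩ := hzo
          exact G.adj_of_no_out_of_out hx hz hxz hxo ha hmx hmz
        · push Not at hzo
          exact ih (ρ z) (by omega) hz hxz hzo hmz (by omega) rfl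
      rcases hadj with h | h
      · have := R.le_succ x z hx hz h
        omega
      · exact (G.qt.adj (hp.snoc h (hnot z)) (by omega)).symm

theorem adj_of_no_out (G : LongGeodesic A k P) {x y : V} {c : ℕ} (hx : OffPath k P x)
    (hy : OffPath k P y) (hxy : x ≠ y)
    (hxo : ∀ c, ¬ OutTo A k P x c) (hyo : ∀ c, ¬ OutTo A k P y c)
    (hmx : Meets A k P x c) (hmy : Meets A k P y (c + 1)) : DAdj A x y := by
  obtain ⟨ρ, R⟩ := G.exists_rank
  rcases le_total (ρ y) (ρ x) with h | h
  · exact G.adj_of_no_out_of_le R hx hy hxy hxo hyo hmx hmy h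
  · exact (G.adj_of_no_out_of_le R hy hx hxy.symm hyo hxo hmy (hmx.congr (by omega)) h).symm

/-- Vertices off `P` that are adjacent to opposite parity classes are adjacent. -/
theorem adj_of_meets (G : LongGeodesic A k P) {x y : V} {c : ℕ} (hx : OffPath k P x)
    (hy : OffPath k P y) (hxy : x ≠ y) (hmx : Meets A k P x c) (hmy : Meets A k P y (c + 1)) :
    DAdj A x y := by
  by_cases hxo : ∃ a, OutTo A k P x a
  · by_cases hyo : ∃ a, OutTo A k P y a
    · obtain ⟨a, ha⟩ := hxo
      obtain ⟨a', ha'⟩ := hyo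
      by_cases hxn : ∃ b, InFrom A k P x b
      · obtain ⟨b, hb⟩ := hxn
        exact G.adj_of_out_in hx hy hxy ha hb hmx hmy
      · by_cases hyn : ∃ b, InFrom A k P y b
        · obtain ⟨b, hb⟩ := hyn
          exact (G.adj_of_out_in hy hx hxy.symm ha' hb hmy (hmx.congr (by omega))).symm
        · push Not at hxn hyn
          have hno : ∀ z, (∀ b, ¬ InFrom A k P z b) →
              ∀ b, ¬ OutTo (fun a b => A b a) k (fun i => P (k + 2 - i)) z b := fun z hz b h =>
            hz (b + 1) (G.outTo_rev.1 (h.congr (by omega)))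
          exact (G.rev.adj_of_no_out hx.rev hy.rev hxy (hno x hxn) (hno y hyn)
            (G.meets_rev.2 hmx) (G.meets_rev.2 hmy)).symm
    · push Not at hyo
      obtain ⟨a, ha⟩ := hxo
      exact (G.adj_of_no_out_of_out hy hx hxy.symm hyo ha hmy (hmx.congr (by omega))).symm
  · push Not at hxo
    by_cases hyo : ∃ a, OutTo A k P y a
    · obtain ⟨a, ha⟩ := hyo
      exact G.adj_of_no_out_of_out hx hy hxy hxo ha hmx hmy
    · push Not at hyo
      exact G.adj_of_no_out hx hy hxy hxo hyo hmx hmy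

/-- If no vertex off `P` is adjacent to both parity classes, then vertices off `P` adjacent to the
same class are not adjacent. -/
theorem no_arc_of_meets (G : LongGeodesic A k P)
    (hnd : ∀ x c, OffPath k P x → Meets A k P x c → ¬ Meets A k P x (c + 1)) {x y : V} {c : ℕ}
    (hx : OffPath k P x) (hy : OffPath k P y) (hxy : x ≠ y) (hmx : Meets A k P x c)
    (hmy : Meets A k P y c) : ¬ A x y := by
  have hk := G.odd
  have h5 := G.five_le
  obtain ⟨ρ, R⟩ := G.exists_rank
  have huniq : ∀ z d e, OffPath k P z → Meets A k P z d → Meets A k P z e → d % 2 = e % 2 := by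
    intro z d e hz hd he
    by_contra hne
    exact hnd z d hz hd (he.congr (by omega))
  induction hs : ρ y using Nat.strong_induction_on generalizing y with
  | _ s ih =>
    subst hs
    intro h
    have hyo : ∀ d, ¬ OutTo A k P y d := fun d hd => by
      have h1 := huniq y c d hy hmy (Or.inl hd)
      have h2 := huniq x c (d + 1) hx hmx (G.meets_of_arc_out hx hy hxy h hd)
      omega
    have hxn : ∀ d, ¬ InFrom A k P x d := fun d hd => by
      have h1 := huniq x c d hx hmx (Or.inr hd)
      have h2 := huniq y c (d + 1) hy hmy (G.meets_of_arc_in hx hy hxy h hd)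
      omega
    have hxo := hmx.resolve_right (hxn c)
    have hyn := hmy.resolve_left (hyo c)
    have hx0 := (R.zero_iff x hx).2 ⟨c, hxo⟩
    have hypos : 0 < ρ y := Nat.pos_of_ne_zero fun h0 => by
      obtain ⟨d, hd⟩ := (R.zero_iff y hy).1 h0
      exact hyo d hd
    have hsink : ∀ q, OffPath k P q → 0 < ρ q → ∃ d, InFrom A k P q d ∧ ¬ OutTo A k P q d := by
      intro q hq hpos
      obtain ⟨d, hd⟩ := G.exists_meets hq
      have hqo : ¬ OutTo A k P q d := fun h' => by
        have := (R.zero_iff q hq).2 ⟨d, h'⟩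
        omega
      exact ⟨d, hd.resolve_left hqo, hqo⟩
    by_cases hlt : ρ y ≤ k - 1
    · obtain ⟨q, hq, hqy, hp⟩ := R.exists_path hy (ρ y - 1) (by omega)
      obtain ⟨z, hz, hqz, hzq⟩ := R.exists_succ q hq (by omega)
      obtain ⟨d, hdn, hdo⟩ := hsink q hq (by omega)
      obtain ⟨e, he⟩ := (R.zero_iff z hz).1 (by omega)
      have hen : InFrom A k P z e := by
        by_contra hen
        exact G.no_arc_sink_source hq hz hdn hdo he hen hqz
      have hxz : x ≠ z := by
        rintro rfl
        exact hxn e hen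
      have hp' := hp.snoc hqz (by rintro ⟨-, rfl | h, -⟩ <;> omega)
      have hS : ∀ w ∈ {w | OffPath k P w ∧ (w = q ∨ ρ q < ρ w) ∧ (w = y ∨ ρ w < ρ y)} ∪ {z},
          OffPath k P w := by
        rintro w (hw | rfl)
        · exact hw.1
        · exact hz
      have hpx := hp'.cons h (by
        rintro (⟨-, rfl | h', -⟩ | h')
        · omega
        · omega
        · exact hxz h')
      have hmy' := G.meets_of_path_out hS hp' he (by omega)
      have h1 := huniq y _ _ hy hmy hmy'
      by_cases hlt' : ρ y ≤ k - 2
      · have hmx' := G.meets_of_path_out (by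
          rintro w (rfl | hw)
          · exact hx
          · exact hS w hw) hpx he (by omega)
        have h2 := huniq x _ _ hx hmx hmx'
        omega
      · rcases G.qt.adj hpx (by omega) with h' | h'
        · have h2 := huniq x _ _ hx hmx (G.meets_of_arc_out hx hz hxz h' he)
          omega
        · have h2 := huniq x _ _ hx hmx (G.meets_of_arc_in hz hx hxz.symm h' hen)
          omega
    · obtain ⟨z, hz, hzy, hp⟩ := R.exists_path hy (k - 1) (by omega)
      have hmz : Meets A k P z c :=
        (G.meets_of_path_in (fun w hw => hw.1) hp hyn (by omega)).congr (by omega)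
      have hxz : x ≠ z := by rintro rfl; omega
      have hpx := hp.cons h (by rintro ⟨-, rfl | h', -⟩ <;> omega)
      rcases G.qt.adj hpx (by omega) with h' | h'
      · exact ih (ρ z) (by omega) hz hxz hmz rfl h'
      · obtain ⟨d, hdn, hdo⟩ := hsink z hz (by omega)
        exact G.no_arc_sink_source hz hx hdn hdo hxo (hxn c) h'

end LongGeodesic

theorem exists_dipath_snoc {A : V → V → Prop} {u y w : V} {n : ℕ}
    (h : ∃ m, m ≤ n ∧ HasDipath A m u y) (ha : A y w) :
    ∃ m, m ≤ n + 1 ∧ HasDipath A m u w := by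
  obtain ⟨m, hm, x, hx, h0, hxm⟩ := h
  by_cases hw : ∃ t, t ≤ m ∧ x t = w
  · obtain ⟨t, ht, htw⟩ := hw
    exact ⟨t, by omega, x, ⟨fun i j hi hj => hx.1 i j (by omega) (by omega),
      fun i hi => hx.2 i (by omega)⟩, h0, htw⟩
  · have hp : PathIn A {z | ∃ t, t ≤ m ∧ x t = z} m u y :=
      ⟨x, hx, h0, hxm, fun i hi => ⟨i, hi, rfl⟩⟩
    obtain ⟨x', hx', h0', hxm', -⟩ := hp.snoc ha hw
    exact ⟨m + 1, by omega, x', hx', h0', hxm'⟩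

theorem HasDipath.reflTransGen {A : V → V → Prop} {u w : V} {n : ℕ} (h : HasDipath A n u w) :
    Relation.ReflTransGen A u w := by
  obtain ⟨x, hx, rfl, rfl⟩ := h
  have : ∀ i, i ≤ n → Relation.ReflTransGen A (x 0) (x i) := fun i => by
    induction i with
    | zero => exact fun _ => .refl
    | succ i ih => exact fun hi => (ih (by omega)).tail (hx.2 i (by omega))
  exact this n le_rfl

theorem LongGeodesic.of_shortest {A : V → V → Prop} {k : ℕ} {P : ℕ → V} (hk5 : 5 ≤ k)
    (hkodd : Odd k) (hQT : KQuasiTransitive A k) (hstrong : StrongD A)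
    (hdist : ∀ m, m < k + 2 → ¬ HasDipath A m (P 0) (P (k + 2)))
    (hP : IsDipathOn A (k + 2) P) : LongGeodesic A k P := by
  have hpre : ∀ j, j ≤ k + 2 → ∃ m, m ≤ j ∧ HasDipath A m (P 0) (P j) := fun j hj =>
    ⟨j, le_rfl, P, ⟨fun a b ha hb => hP.1 a b (by omega) (by omega),
      fun i hi => hP.2 i (by omega)⟩, rfl, rfl⟩
  have hle : ∀ n i, i ≤ k + 2 → (∃ m, m ≤ n ∧ HasDipath A m (P 0) (P i)) → i ≤ n := by
    intro n i hi h
    have hext : ∀ t, i + t ≤ k + 2 → ∃ m, m ≤ n + t ∧ HasDipath A m (P 0) (P (i + t)) := by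
      intro t
      induction t with
      | zero => exact fun _ => h
      | succ t ih => exact fun ht => exists_dipath_snoc (ih (by omega)) (hP.2 _ (by omega))
    obtain ⟨m, hm, hd⟩ := hext (k + 2 - i) (by omega)
    rw [show i + (k + 2 - i) = k + 2 by omega] at hd
    by_contra hlt
    exact hdist m (by omega) hd
  refine ⟨hk5, Nat.odd_iff.1 hkodd, hQT, hP.1, hP.2, ?_, ?_, ?_, ?_⟩
  · exact fun i j hi hj h => hle _ i hi (exists_dipath_snoc (hpre j hj) h)
  · exact fun i j x hi hj h h' =>
      hle _ i hi (exists_dipath_snoc (exists_dipath_snoc (hpre j hj) h) h')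
  · exact fun i j x y hi hj h h' h'' =>
      hle _ i hi (exists_dipath_snoc (exists_dipath_snoc (exists_dipath_snoc (hpre j hj) h) h') h'')
  · intro a b
    obtain ⟨n, hn⟩ := hstrong a b
    exact hn.reflTransGen

theorem stmt_15
    {V : Type*} [Fintype V] (A : V → V → Prop) (hirr : Irreflexive A)
    (k : ℕ) (hk5 : 5 ≤ k) (hkodd : Odd k)
    (hQT : KQuasiTransitive A k) (hstrong : StrongD A)
    (u v : V) (hdist : ∀ m, m < k + 2 → ¬ HasDipath A m u v)
    (P : ℕ → V) (hP : IsDipathOn A (k + 2) P) (hPu : P 0 = u) (hPv : P (k + 2) = v) :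
    SemicompleteOn A {w | w ∉ VertsUpTo (k + 2) P} ∨
      SemicompleteBipartiteOn A {w | w ∉ VertsUpTo (k + 2) P} ∨
      EmptyOn A {w | w ∉ VertsUpTo (k + 2) P} := by
  subst hPu hPv
  have G := LongGeodesic.of_shortest hk5 hkodd hQT hstrong hdist hP
  have hoff : ∀ w, w ∉ VertsUpTo (k + 2) P ↔ OffPath k P w := fun w => by
    simp [VertsUpTo, OffPath]
  simp only [hoff]
  by_cases hd : ∃ x c, OffPath k P x ∧ Meets A k P x c ∧ Meets A k P x (c + 1)
  · obtain ⟨z, c, hz, h, h'⟩ := hd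
    exact Or.inl fun x hx y hy hxy => G.adj_of_meets (c := 0) hx hy hxy
      (G.meets_of_meets hz hx h h' _) (G.meets_of_meets hz hy h h' _)
  · have hnd : ∀ x c, OffPath k P x → Meets A k P x c → ¬ Meets A k P x (c + 1) :=
      fun x c hx h h' => hd ⟨x, c, hx, h, h'⟩
    have hnadj : ∀ c x y, OffPath k P x ∧ Meets A k P x c → OffPath k P y ∧ Meets A k P y c →
        ¬ DAdj A x y := by
      rintro c x y ⟨hx, hmx⟩ ⟨hy, hmy⟩ h
      by_cases hxy : x = y
      · subst hxy
        exact h.elim (hirr x) (hirr x)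
      · exact h.elim (G.no_arc_of_meets hnd hx hy hxy hmx hmy)
          (G.no_arc_of_meets hnd hy hx (Ne.symm hxy) hmy hmx)
    refine Or.inr (Or.inl ⟨{x | OffPath k P x ∧ Meets A k P x 0},
      {x | OffPath k P x ∧ Meets A k P x 1}, ?_, ?_, fun x hx y hy => hnadj 0 x y hx hy,
      fun x hx y hy => hnadj 1 x y hx hy, ?_⟩)
    · ext x
      constructor
      · rintro (h | h) <;> exact h.1
      · intro hx
        obtain ⟨c, hc⟩ := G.exists_meets hx
        rcases Nat.mod_two_eq_zero_or_one c with h | h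
        · exact Or.inl ⟨hx, hc.congr h⟩
        · exact Or.inr ⟨hx, hc.congr h⟩
    · ext x
      constructor
      · rintro ⟨⟨hx, h0⟩, -, h1⟩
        exact hnd x 0 hx h0 h1
      · exact False.elim
    · rintro x ⟨hx, h0⟩ y ⟨hy, h1⟩
      refine G.adj_of_meets hx hy ?_ h0 h1
      rintro rfl
      exact hnd x 0 hx h0 h1
end

section
/- Suppose the induced subdigraph D[V(P)] is a semicomplete bipartite digraph. Define B_1 = {x ∈ B : x is adjacent to some vertex of E(P)} and B_2 = {x ∈ B : x is adjacent to some vertex of O(P)}. Then B_1 ∩ B_2 = ∅; that is, no vertex of B is adjacent both to a vertex of E(P) and to a vertex of O(P). Moreover, every vertex of B_1 is adjacent to every vertex of B_2, and no two vertices of B_1 are adjacent and no two vertices of B_2 are adjacent. -/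
variable {V : Type*}

/-- A path `P 0, …, P (k + 2)` of a `k`-quasi-transitive digraph (`k ≥ 5` odd) that induces a
semicomplete bipartite digraph and cannot be shortened, neither by an arc between two of its
vertices nor by a detour through a single outside vertex. -/
structure BipartiteGeodesic (A : V → V → Prop) (k : ℕ) (P : ℕ → V) : Prop where
  five_le : 5 ≤ k
  odd : k % 2 = 1
  quasi : KQuasiTransitive A k
  inj : ∀ i j, i ≤ k + 2 → j ≤ k + 2 → P i = P j → i = j
  step : ∀ i, i < k + 2 → A (P i) (P (i + 1))
  back : ∀ i j, i ≤ k + 2 → j + 3 ≤ i → (i - j) % 2 = 1 → A (P i) (P j)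
  not_adj : ∀ i j, i ≤ k + 2 → j ≤ k + 2 → i % 2 = j % 2 → ¬ DAdj A (P i) (P j)
  detour : ∀ x a b, (∀ i ≤ k + 2, P i ≠ x) → a ≤ k + 2 → b ≤ k + 2 →
    A (P a) x → A x (P b) → b ≤ a + 2

/-- The sequence `P 0, …, P n, x, y, y, …`. -/
def extendPath (n : ℕ) (P : ℕ → V) (x y : V) (i : ℕ) : V :=
  if i ≤ n then P i else if i = n + 1 then x else y

theorem extendPath_of_le {n i : ℕ} (P : ℕ → V) (x y : V) (h : i ≤ n) :
    extendPath n P x y i = P i := if_pos h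

@[simp] theorem extendPath_succ (n : ℕ) (P : ℕ → V) (x y : V) :
    extendPath n P x y (n + 1) = x := by simp [extendPath]

@[simp] theorem extendPath_succ_succ (n : ℕ) (P : ℕ → V) (x y : V) :
    extendPath n P x y (n + 2) = y := by simp [extendPath]

namespace BipartiteGeodesic

variable {A : V → V → Prop} {k : ℕ} {P : ℕ → V} {x y : V}

/-- Reversing all arcs and the path. -/
theorem reverse (h : BipartiteGeodesic A k P) :
    BipartiteGeodesic (fun x y => A y x) k (fun i => P (k + 2 - i)) where
  five_le := h.five_le
  odd := h.odd
  quasi := by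
    intro z hz
    have := h.quasi (fun i => z (k - i)) ⟨fun i j hi hj hij => by
      have := hz.1 _ _ (by omega) (by omega) hij
      omega, fun i hi => by
      have := hz.2 (k - (i + 1)) (by omega)
      rwa [show k - (i + 1) + 1 = k - i by omega] at this⟩
    simpa [DAdj] using this
  inj i j hi hj hij := by
    have := h.inj _ _ (by omega) (by omega) hij
    omega
  step i hi := by
    have := h.step (k + 2 - (i + 1)) (by omega)
    rwa [show k + 2 - (i + 1) + 1 = k + 2 - i by omega] at this
  back i j hi hj hij := h.back _ _ (by omega) (by omega) (by omega)
  not_adj i j hi hj hij := fun hadj =>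
    h.not_adj (k + 2 - i) (k + 2 - j) (by omega) (by omega) (by omega) hadj.symm
  detour x a b hx ha hb hax hxb := by
    have := h.detour x (k + 2 - b) (k + 2 - a)
      (fun i hi => by
        have := hx (k + 2 - i) (by omega)
        rwa [show k + 2 - (k + 2 - i) = i by omega] at this)
      (by omega) (by omega) hxb hax
    omega

theorem ne_reverse (hx : ∀ i ≤ k + 2, P i ≠ x) : ∀ i ≤ k + 2, P (k + 2 - i) ≠ x :=
  fun _ _ => hx _ (by omega)

/-- A path of length `k` through `P` and outside vertices `x`, `y`, described by the indices of its
vertices in `extendPath`; the arcs not known from `P` are listed by `E`. -/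
theorem adj_of_indices (h : BipartiteGeodesic A k P) (N : ℕ)
    (hQ : ∀ i j, i ≤ N → j ≤ N →
      extendPath (k + 2) P x y i = extendPath (k + 2) P x y j → i = j)
    (E : ℕ → ℕ → Prop)
    (hE : ∀ i j, E i j → A (extendPath (k + 2) P x y i) (extendPath (k + 2) P x y j))
    (g : ℕ → ℕ) (hgN : ∀ i ≤ k, g i ≤ N)
    (hg : ∀ i j, i ≤ k → j ≤ k → g i = g j → i = j)
    (harc : ∀ i, i < k → (g (i + 1) = g i + 1 ∧ g (i + 1) ≤ k + 2) ∨
      (g (i + 1) + 3 ≤ g i ∧ g i ≤ k + 2 ∧ (g i - g (i + 1)) % 2 = 1) ∨ E (g i) (g (i + 1))) :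
    DAdj A (extendPath (k + 2) P x y (g 0)) (extendPath (k + 2) P x y (g k)) := by
  refine h.quasi (fun i => extendPath (k + 2) P x y (g i)) ⟨fun i j hi hj hij =>
    hg i j hi hj (hQ _ _ (hgN i hi) (hgN j hj) hij), fun i hi => ?_⟩
  rcases harc i hi with ⟨h1, h2⟩ | ⟨h1, h2, h3⟩ | h1
  · have := h.step (g i) (by omega)
    rwa [← h1, ← extendPath_of_le P x y h2,
      ← extendPath_of_le P x y (show g i ≤ k + 2 by omega)] at this
  · have := h.back _ _ h2 h1 h3
    rwa [← extendPath_of_le P x y h2,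
      ← extendPath_of_le P x y (show g (i + 1) ≤ k + 2 by omega)] at this
  · exact hE _ _ h1

theorem extendPath_inj_one (h : BipartiteGeodesic A k P) (hx : ∀ i ≤ k + 2, P i ≠ x) :
    ∀ i j, i ≤ k + 3 → j ≤ k + 3 →
      extendPath (k + 2) P x y i = extendPath (k + 2) P x y j → i = j := by
  intro i j hi hj hij
  unfold extendPath at hij
  have := h.inj i j
  have := hx i
  have := hx j
  grind

theorem extendPath_inj_two (h : BipartiteGeodesic A k P) (hx : ∀ i ≤ k + 2, P i ≠ x)
    (hy : ∀ i ≤ k + 2, P i ≠ y) (hxy : x ≠ y) :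
    ∀ i j, i ≤ k + 4 → j ≤ k + 4 →
      extendPath (k + 2) P x y i = extendPath (k + 2) P x y j → i = j := by
  intro i j hi hj hij
  unfold extendPath at hij
  have := h.inj i j
  have := hx i
  have := hx j
  have := hy i
  have := hy j
  grind

/-- `adj_of_indices` for paths ending in `a → x`. -/
theorem adj_of_indices_in (h : BipartiteGeodesic A k P) (hx : ∀ i ≤ k + 2, P i ≠ x) {a : ℕ}
    (ha : a ≤ k + 2) (hax : A (P a) x) (g : ℕ → ℕ) (hgN : ∀ i ≤ k, g i ≤ k + 3)
    (hg : ∀ i j, i ≤ k → j ≤ k → g i = g j → i = j)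
    (harc : ∀ i, i < k → (g (i + 1) = g i + 1 ∧ g (i + 1) ≤ k + 2) ∨
      (g (i + 1) + 3 ≤ g i ∧ g i ≤ k + 2 ∧ (g i - g (i + 1)) % 2 = 1) ∨
      (g i = a ∧ g (i + 1) = k + 3)) (hgk : g k = k + 3) (h0 : g 0 ≤ k + 2) :
    DAdj A (P (g 0)) x := by
  have := h.adj_of_indices (x := x) (y := x) (k + 3) (h.extendPath_inj_one hx)
    (fun i j => i = a ∧ j = k + 3)
    (by rintro i j ⟨rfl, rfl⟩; rw [extendPath_of_le P x x ha]; simpa using hax) g hgN hg harc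
  rwa [hgk, extendPath_of_le P x x h0, extendPath_succ] at this

/-- No path of length `k` through `a → x → b` joins two vertices of `P` of the same parity. -/
theorem not_indices_through (h : BipartiteGeodesic A k P) (hx : ∀ i ≤ k + 2, P i ≠ x) {a b : ℕ}
    (ha : a ≤ k + 2) (hb : b ≤ k + 2) (hax : A (P a) x) (hxb : A x (P b))
    (g : ℕ → ℕ) (hgN : ∀ i ≤ k, g i ≤ k + 3)
    (hg : ∀ i j, i ≤ k → j ≤ k → g i = g j → i = j)
    (harc : ∀ i, i < k → (g (i + 1) = g i + 1 ∧ g (i + 1) ≤ k + 2) ∨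
      (g (i + 1) + 3 ≤ g i ∧ g i ≤ k + 2 ∧ (g i - g (i + 1)) % 2 = 1) ∨
      ((g i = a ∧ g (i + 1) = k + 3) ∨ (g i = k + 3 ∧ g (i + 1) = b)))
    (h0 : g 0 ≤ k + 2) (hgk : g k ≤ k + 2) (hpar : g 0 % 2 = g k % 2) : False := by
  have := h.adj_of_indices (x := x) (y := x) (k + 3) (h.extendPath_inj_one hx)
    (fun i j => (i = a ∧ j = k + 3) ∨ (i = k + 3 ∧ j = b))
    (by
      rintro i j (⟨rfl, rfl⟩ | ⟨rfl, rfl⟩)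
      · rw [extendPath_of_le P x x ha]; simpa using hax
      · rw [extendPath_of_le P x x hb]; simpa using hxb) g hgN hg harc
  rw [extendPath_of_le P x x h0, extendPath_of_le P x x hgk] at this
  exact h.not_adj _ _ h0 hgk hpar this

/-- No path of length `k` through `a → x → y → b` joins two vertices of `P` of the same parity. -/
theorem not_indices_through_two (h : BipartiteGeodesic A k P) (hx : ∀ i ≤ k + 2, P i ≠ x)
    (hy : ∀ i ≤ k + 2, P i ≠ y) (hne : x ≠ y) {a b : ℕ}
    (ha : a ≤ k + 2) (hb : b ≤ k + 2) (hax : A (P a) x) (hxy : A x y) (hyb : A y (P b))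
    (g : ℕ → ℕ) (hgN : ∀ i ≤ k, g i ≤ k + 4)
    (hg : ∀ i j, i ≤ k → j ≤ k → g i = g j → i = j)
    (harc : ∀ i, i < k → (g (i + 1) = g i + 1 ∧ g (i + 1) ≤ k + 2) ∨
      (g (i + 1) + 3 ≤ g i ∧ g i ≤ k + 2 ∧ (g i - g (i + 1)) % 2 = 1) ∨
      ((g i = a ∧ g (i + 1) = k + 3) ∨ (g i = k + 3 ∧ g (i + 1) = k + 4) ∨
        (g i = k + 4 ∧ g (i + 1) = b)))
    (h0 : g 0 ≤ k + 2) (hgk : g k ≤ k + 2) (hpar : g 0 % 2 = g k % 2) : False := by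
  have := h.adj_of_indices (x := x) (y := y) (k + 4) (h.extendPath_inj_two hx hy hne)
    (fun i j => (i = a ∧ j = k + 3) ∨ (i = k + 3 ∧ j = k + 4) ∨ (i = k + 4 ∧ j = b))
    (by
      rintro i j (⟨rfl, rfl⟩ | ⟨rfl, rfl⟩ | ⟨rfl, rfl⟩)
      · rw [extendPath_of_le P x y ha]; simpa using hax
      · simpa using hxy
      · rw [extendPath_of_le P x y hb]; simpa using hyb) g hgN hg harc
  rw [extendPath_of_le P x y h0, extendPath_of_le P x y hgk] at this
  exact h.not_adj _ _ h0 hgk hpar this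

theorem adj_in_add_two (h : BipartiteGeodesic A k P) (hx : ∀ i ≤ k + 2, P i ≠ x) {a : ℕ}
    (h2 : 2 ≤ a) (ha : a ≤ k) (hax : A (P a) x) : DAdj A (P (a + 2)) x := by
  have hk := h.five_le
  have ho := h.odd
  have := h.adj_of_indices_in hx (by omega) hax
    (fun i => if i + a ≤ k then a + 2 + i else if i < k then i + a + 1 - k else k + 3)
    (fun i hi => by split_ifs <;> omega)
    (fun i j hi hj hij => by split_ifs at hij <;> omega)
    (fun i hi => by split_ifs <;> omega)
    (by split_ifs <;> omega) (by split_ifs <;> omega)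
  simpa [ha] using this

theorem in_add_four (h : BipartiteGeodesic A k P) (hx : ∀ i ≤ k + 2, P i ≠ x) {a : ℕ}
    (ha : a + 2 ≤ k) (hax : A (P a) x) : A (P (a + 4)) x := by
  have hk := h.five_le
  have ho := h.odd
  have := h.adj_of_indices_in hx (by omega) hax
    (fun i => if i + a + 2 ≤ k then a + 4 + i else if i < k then i + a + 1 - k else k + 3)
    (fun i hi => by split_ifs <;> omega)
    (fun i j hi hj hij => by split_ifs at hij <;> omega)
    (fun i hi => by split_ifs <;> omega)
    (by split_ifs <;> omega) (by split_ifs <;> omega)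
  simp only [zero_add, ha, if_true, add_zero] at this
  refine this.resolve_right fun hc => ?_
  have := h.detour x a (a + 4) hx (by omega) (by omega) hax hc
  omega

theorem in_of_le (h : BipartiteGeodesic A k P) (hx : ∀ i ≤ k + 2, P i ≠ x) {a c : ℕ}
    (hax : A (P a) x) (hac : a ≤ c) (hc : c ≤ k + 2) (hmod : a % 4 = c % 4) : A (P c) x := by
  obtain ⟨d, rfl⟩ : ∃ d, c = a + 4 * d := ⟨(c - a) / 4, by omega⟩
  clear hac hmod
  induction d with
  | zero => exact hax
  | succ d ih =>
    have := h.in_add_four hx (a := a + 4 * d) (by omega) (ih (by omega))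
    rwa [show a + 4 * d + 4 = a + 4 * (d + 1) by ring] at this

theorem out_of_le (h : BipartiteGeodesic A k P) (hx : ∀ i ≤ k + 2, P i ≠ x) {b c : ℕ}
    (hxb : A x (P b)) (hcb : c ≤ b) (hb : b ≤ k + 2) (hmod : b % 4 = c % 4) : A x (P c) := by
  have := h.reverse.in_of_le (ne_reverse hx) (a := k + 2 - b) (c := k + 2 - c)
    (by rwa [show k + 2 - (k + 2 - b) = b by omega]) (by omega) (by omega) (by omega)
  rwa [show k + 2 - (k + 2 - c) = c by omega] at this

theorem adj_out_sub_two (h : BipartiteGeodesic A k P) (hx : ∀ i ≤ k + 2, P i ≠ x) {b : ℕ}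
    (hb : b + 2 ≤ k) (hxb : A x (P (b + 2))) : DAdj A x (P b) := by
  have := h.reverse.adj_in_add_two (ne_reverse hx) (a := k - b)
    (by omega) (by omega) (by rwa [show k + 2 - (k - b) = b + 2 by omega])
  rw [show k + 2 - (k - b + 2) = b by omega] at this
  exact this

theorem exists_in_top (h : BipartiteGeodesic A k P) (hx : ∀ i ≤ k + 2, P i ≠ x) {a : ℕ}
    (ha : a ≤ k + 2) (hax : A (P a) x) :
    ∃ c, c ≤ 3 ∧ (k + 2 - c) % 2 = a % 2 ∧ A (P (k + 2 - c)) x :=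
  have := h.five_le
  ⟨(k + 2 - a) % 4, by omega, by omega, h.in_of_le hx hax (by omega) (by omega) (by omega)⟩

theorem exists_out_bottom (h : BipartiteGeodesic A k P) (hx : ∀ i ≤ k + 2, P i ≠ x) {b : ℕ}
    (hb : b ≤ k + 2) (hxb : A x (P b)) : ∃ d, d ≤ 3 ∧ d % 2 = b % 2 ∧ A x (P d) :=
  ⟨b % 4, by omega, by omega, h.out_of_le hx hxb (by omega) (by omega) (by omega)⟩

set_option maxHeartbeats 1000000 in
/-- In- and out-neighbours on `P` of an outside vertex have indices of the same parity. -/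
theorem parity_in_out (h : BipartiteGeodesic A k P) (hx : ∀ i ≤ k + 2, P i ≠ x) {a b : ℕ}
    (ha : a ≤ k + 2) (hb : b ≤ k + 2) (hax : A (P a) x) (hxb : A x (P b)) : a % 2 = b % 2 := by
  by_contra hpar
  obtain ⟨c, hc, hca, hcx⟩ := h.exists_in_top hx ha hax
  obtain ⟨d, hd, hdb, hxd⟩ := h.exists_out_bottom hx hb hxb
  have hk := h.five_le
  have ho := h.odd
  have key := h.not_indices_through hx (by omega) (by omega) hcx hxd
  have hcd : (c + d) % 2 = 0 := by omega
  clear hca hdb hpar hax hxb ha hb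
  obtain hlow | ⟨rfl, rfl⟩ | ⟨rfl, rfl⟩ | ⟨rfl, rfl⟩ | ⟨rfl, rfl⟩ :
      c + d ≤ 2 ∨ (c = 2 ∧ d = 2) ∨ (c = 3 ∧ d = 3) ∨ (c = 1 ∧ d = 3) ∨ (c = 3 ∧ d = 1) := by
    omega
  · exact key (fun i => if i + 1 < k then i + 4 - c else if i + 1 = k then k + 3 else d)
      (fun i hi => by split_ifs <;> omega)
      (fun i j hi hj hij => by split_ifs at hij <;> first | contradiction | omega)
      (fun i hi => by split_ifs <;> first | contradiction | omega)
      (by split_ifs <;> omega) (by split_ifs <;> omega) (by split_ifs <;> omega)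
  · exact key (fun i => if i = 0 then k + 2 else if i + 3 ≤ k then i + 3 else
      if i + 2 = k then k + 3 else i + 3 - k)
      (fun i hi => by split_ifs <;> omega)
      (fun i j hi hj hij => by split_ifs at hij <;> first | contradiction | omega)
      (fun i hi => by split_ifs <;> first | contradiction | omega)
      (by split_ifs <;> omega) (by split_ifs <;> omega) (by split_ifs <;> omega)
  · exact key (fun i => if i = 0 then k + 2 else if i + 4 ≤ k then i + 3 else
      if i + 3 = k then k + 3 else if i + 2 = k then 3 else i + 1 - k)
      (fun i hi => by split_ifs <;> omega)
      (fun i j hi hj hij => by split_ifs at hij <;> first | contradiction | omega)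
      (fun i hi => by split_ifs <;> first | contradiction | omega)
      (by split_ifs <;> omega) (by split_ifs <;> omega) (by split_ifs <;> omega)
  · exact key (fun i => if i + 3 ≤ k then i + 4 else if i + 2 = k then k + 3 else
      if i + 1 = k then 3 else 0)
      (fun i hi => by split_ifs <;> omega)
      (fun i j hi hj hij => by split_ifs at hij <;> first | contradiction | omega)
      (fun i hi => by split_ifs <;> first | contradiction | omega)
      (by split_ifs <;> omega) (by split_ifs <;> omega) (by split_ifs <;> omega)
  · exact key (fun i => if i = 0 then k + 2 else if i = 1 then k - 1 else if i = 2 then k + 3 else i - 2)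
      (fun i hi => by split_ifs <;> omega)
      (fun i j hi hj hij => by split_ifs at hij <;> first | contradiction | omega)
      (fun i hi => by split_ifs <;> first | contradiction | omega)
      (by split_ifs <;> omega) (by split_ifs <;> omega) (by split_ifs <;> omega)

set_option maxHeartbeats 1000000 in
/-- There is no arc between outside vertices attached to the same side of `P`. -/
theorem not_arc_of_parity (h : BipartiteGeodesic A k P) (hx : ∀ i ≤ k + 2, P i ≠ x)
    (hy : ∀ i ≤ k + 2, P i ≠ y) (hne : x ≠ y) {a b : ℕ} (ha : a ≤ k + 2) (hb : b ≤ k + 2)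
    (hax : A (P a) x) (hyb : A y (P b)) (hpar : a % 2 = b % 2) : ¬ A x y := by
  intro hxy
  obtain ⟨c, hc, hca, hcx⟩ := h.exists_in_top hx ha hax
  obtain ⟨d, hd, hdb, hyd⟩ := h.exists_out_bottom hy hb hyb
  have hk := h.five_le
  have ho := h.odd
  have key := h.not_indices_through_two hx hy hne (by omega) (by omega) hcx hxy hyd
  have hcd : (c + d) % 2 = 1 := by omega
  clear hca hdb hpar hax hyb ha hb
  obtain hlow | ⟨rfl, rfl⟩ | ⟨rfl, rfl⟩ :
      c + d ≤ 3 ∨ (c = 2 ∧ d = 3) ∨ (c = 3 ∧ d = 2) := by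
    omega
  · exact key (fun i => if i + 3 ≤ k then i + 5 - c else if i + 2 = k then k + 3 else
      if i + 1 = k then k + 4 else d)
      (fun i hi => by split_ifs <;> omega)
      (fun i j hi hj hij => by split_ifs at hij <;> first | contradiction | omega)
      (fun i hi => by split_ifs <;> first | contradiction | omega)
      (by split_ifs <;> omega) (by split_ifs <;> omega) (by split_ifs <;> omega)
  · exact key (fun i => if i = 0 then k + 2 else if i + 3 ≤ k then i + 3 else
      if i + 2 = k then k + 3 else if i + 1 = k then k + 4 else 3)
      (fun i hi => by split_ifs <;> omega)
      (fun i j hi hj hij => by split_ifs at hij <;> first | contradiction | omega)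
      (fun i hi => by split_ifs <;> first | contradiction | omega)
      (by split_ifs <;> omega) (by split_ifs <;> omega) (by split_ifs <;> omega)
  · exact key (fun i => if i + 5 ≤ k then i + 4 else if i + 4 = k then k + 3 else if i + 3 = k then k + 4 else
      if i + 2 = k then 2 else if i + 1 = k then 3 else 0)
      (fun i hi => by split_ifs <;> omega)
      (fun i j hi hj hij => by split_ifs at hij <;> first | contradiction | omega)
      (fun i hi => by split_ifs <;> first | contradiction | omega)
      (by split_ifs <;> omega) (by split_ifs <;> omega) (by split_ifs <;> omega)

theorem adj_of_out_zero (h : BipartiteGeodesic A k P) (hx : ∀ i ≤ k + 2, P i ≠ x)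
    (hx0 : A x (P 0)) : DAdj A x (P (k - 1)) := by
  have hk := h.five_le
  have := h.adj_of_indices (x := x) (y := x) (k + 3) (h.extendPath_inj_one hx)
    (fun i j => i = k + 3 ∧ j = 0)
    (by rintro i j ⟨rfl, rfl⟩; rw [extendPath_of_le P x x (Nat.zero_le _)]; simpa using hx0)
    (fun i => if i = 0 then k + 3 else i - 1)
    (fun i hi => by split_ifs <;> omega)
    (fun i j hi hj hij => by split_ifs at hij <;> omega)
    (fun i hi => by grind)
  rwa [if_pos rfl, if_neg (by omega), extendPath_succ,
    extendPath_of_le P x x (by omega)] at this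

/-- A path `x → b → ⋯ → b + k - 2 → y` makes `x` and `y` adjacent. -/
theorem adj_of_out_in (h : BipartiteGeodesic A k P) (hx : ∀ i ≤ k + 2, P i ≠ x)
    (hy : ∀ i ≤ k + 2, P i ≠ y) (hne : x ≠ y) {b : ℕ} (hb : b ≤ 4)
    (hxb : A x (P b)) (hby : A (P (b + k - 2)) y) : DAdj A x y := by
  have hk := h.five_le
  have := h.adj_of_indices (x := x) (y := y) (k + 4) (h.extendPath_inj_two hx hy hne)
    (fun i j => (i = k + 3 ∧ j = b) ∨ (i = b + k - 2 ∧ j = k + 4))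
    (by
      rintro i j (⟨rfl, rfl⟩ | ⟨rfl, rfl⟩)
      · rw [extendPath_succ, extendPath_of_le P x y (by omega)]; exact hxb
      · rw [extendPath_succ_succ, extendPath_of_le P x y (by omega)]; exact hby)
    (fun i => if i = 0 then k + 3 else if i < k then b + i - 1 else k + 4)
    (fun i hi => by split_ifs <;> omega)
    (fun i j hi hj hij => by split_ifs at hij <;> omega)
    (fun i hi => by grind)
  rwa [if_pos rfl, if_neg (by omega), if_neg (by omega), extendPath_succ,
    extendPath_succ_succ] at this

theorem adj_top_even (h : BipartiteGeodesic A k P) (hx : ∀ i ≤ k + 2, P i ≠ x) {a b : ℕ}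
    (ha : a ≤ k + 2) (hb : b ≤ k + 2) (hax : A (P a) x) (hxb : A x (P b))
    (ha2 : a % 2 = 0) (hb2 : b % 2 = 0) : DAdj A x (P (k + 1)) ∧ DAdj A x (P (k - 1)) := by
  have hk := h.five_le
  have ho := h.odd
  obtain ⟨c, hc, hca, hcx⟩ := h.exists_in_top hx ha hax
  obtain ⟨d, hd, hdb, hxd⟩ := h.exists_out_bottom hx hb hxb
  obtain rfl | rfl : c = 3 ∨ c = 1 := by omega
  · rw [show k + 2 - 3 = k - 1 by omega] at hcx
    have := h.adj_in_add_two hx (by omega) (by omega) hcx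
    rw [show k - 1 + 2 = k + 1 by omega] at this
    exact ⟨this.symm, Or.inr hcx⟩
  refine ⟨Or.inr hcx, ?_⟩
  obtain rfl | rfl : d = 0 ∨ d = 2 := by omega
  · exact h.adj_of_out_zero hx hxd
  rcases h.adj_out_sub_two hx (b := 0) (by omega) hxd with h0 | h0
  · exact h.adj_of_out_zero hx h0
  have hin : ∀ m, 2 * m + 4 ≤ k + 2 → A (P (2 * m + 4)) x := by
    intro m
    induction m with
    | zero => exact fun _ => h.in_add_four hx (by omega) h0
    | succ m ih =>
      intro hm
      have := h.adj_in_add_two hx (a := 2 * m + 4) (by omega) (by omega) (ih (by omega))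
      refine this.resolve_right fun hc => ?_
      have := h.detour x 0 (2 * m + 4 + 2) hx (by omega) (by omega) h0 hc
      omega
  have := hin ((k - 5) / 2) (by omega)
  rw [show 2 * ((k - 5) / 2) + 4 = k - 1 by omega] at this
  exact Or.inr this

theorem adj_bottom_odd (h : BipartiteGeodesic A k P) (hy : ∀ i ≤ k + 2, P i ≠ y) {a b : ℕ}
    (ha : a ≤ k + 2) (hb : b ≤ k + 2) (hay : A (P a) y) (hyb : A y (P b))
    (ha2 : a % 2 = 1) (hb2 : b % 2 = 1) : DAdj A y (P 1) ∧ DAdj A y (P 3) := by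
  have hk := h.five_le
  have ho := h.odd
  have := h.reverse.adj_top_even (ne_reverse hy) (a := k + 2 - b) (b := k + 2 - a)
    (by omega) (by omega) (by rwa [show k + 2 - (k + 2 - b) = b by omega])
    (by rwa [show k + 2 - (k + 2 - a) = a by omega]) (by omega) (by omega)
  rw [show k + 2 - (k + 1) = 1 by omega, show k + 2 - (k - 1) = 3 by omega] at this
  exact ⟨Or.symm this.1, Or.symm this.2⟩

/-- Outside vertices attached to opposite sides of `P` are adjacent. -/
theorem adj_of_even_odd (h : BipartiteGeodesic A k P) (hx : ∀ i ≤ k + 2, P i ≠ x)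
    (hy : ∀ i ≤ k + 2, P i ≠ y) (hne : x ≠ y) {a b c d : ℕ}
    (ha : a ≤ k + 2) (hb : b ≤ k + 2) (hc : c ≤ k + 2) (hd : d ≤ k + 2)
    (hax : A (P a) x) (hxb : A x (P b)) (hcy : A (P c) y) (hyd : A y (P d))
    (ha2 : a % 2 = 0) (hb2 : b % 2 = 0) (hc2 : c % 2 = 1) (hd2 : d % 2 = 1) : DAdj A x y := by
  have hk := h.five_le
  have ho := h.odd
  obtain ⟨htop, htop'⟩ := h.adj_top_even hx ha hb hax hxb ha2 hb2
  obtain ⟨hbot, hbot'⟩ := h.adj_bottom_odd hy hc hd hcy hyd hc2 hd2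
  have hin : A (P (k + 1)) x ∨ A (P (k - 1)) x := by
    obtain ⟨e, he, hea, hex⟩ := h.exists_in_top hx ha hax
    obtain rfl | rfl : e = 1 ∨ e = 3 := by omega
    · exact Or.inl hex
    · rw [show k + 2 - 3 = k - 1 by omega] at hex
      exact Or.inr hex
  have hout : A y (P 1) ∨ A y (P 3) := by
    obtain ⟨e, he, hed, hye⟩ := h.exists_out_bottom hy hd hyd
    obtain rfl | rfl : e = 1 ∨ e = 3 := by omega
    · exact Or.inl hye
    · exact Or.inr hye
  by_contra hnadj
  have hyx : ∀ e ≤ 4, A y (P e) → ¬ A (P (e + k - 2)) x := fun e he h1 h2 =>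
    hnadj (h.adj_of_out_in hy hx hne.symm he h1 h2).symm
  have hxy : ∀ e ≤ 4, A x (P e) → ¬ A (P (e + k - 2)) y := fun e he h1 h2 =>
    hnadj (h.adj_of_out_in hx hy hne he h1 h2)
  have hyx1 := hyx 1 (by omega)
  have hyx3 := hyx 3 (by omega)
  rw [show 1 + k - 2 = k - 1 by omega] at hyx1
  rw [show 3 + k - 2 = k + 1 by omega] at hyx3
  -- Moving the out-neighbour `p` of `x` down and the in-neighbour `q` of `y` up in steps of four.
  have hmove : ∀ p q, 4 ≤ p → p ≤ k + 2 → q ≤ 3 → p % 2 = 0 → (q + 2 + p) % 4 = (k + 4) % 4 →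
      A x (P p) → ¬ A (P q) y := by
    intro p q hp hpk hq hp2 hpq hxp hqy
    rcases (by omega : p % 4 = 0 ∨ p % 4 = 2) with h4 | h4
    · refine hxy 4 le_rfl (h.out_of_le hx hxp hp hpk (by omega)) ?_
      exact h.in_of_le hy hqy (by omega) (by omega) (by omega)
    · refine hxy 2 (by omega) (h.out_of_le hx hxp (by omega) hpk (by omega)) ?_
      exact h.in_of_le hy hqy (by omega) (by omega) (by omega)
  by_cases hy1 : A y (P 1)
  · have hn := hyx1 hy1
    have hin' := hin.resolve_right hn
    have h3y := hbot'.resolve_left fun h3 => hyx3 h3 hin'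
    exact hmove (k - 1) 3 (by omega) (by omega) (by omega) (by omega) (by omega)
      (htop'.resolve_right hn) h3y
  · have hn := hyx3 (hout.resolve_left hy1)
    exact hmove (k + 1) 1 (by omega) (by omega) (by omega) (by omega) (by omega)
      (htop.resolve_right hn) (hbot.resolve_left hy1)

end BipartiteGeodesic

theorem hasDipath_of_skip {A : V → V → Prop} {n : ℕ} {P : ℕ → V} (hP : IsDipathOn A n P)
    {a b : ℕ} (hab : a < b) (hb : b ≤ n) (harc : A (P a) (P b)) :
    HasDipath A (a + 1 + (n - b)) (P 0) (P n) := by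
  refine ⟨fun i => P (if i ≤ a then i else i + b - a - 1), ⟨fun i j hi hj hij => ?_,
    fun i hi => ?_⟩, by simp, ?_⟩
  · have := hP.1 _ _ (by split_ifs <;> omega) (by split_ifs <;> omega) hij
    split_ifs at this <;> omega
  · rcases lt_trichotomy i a with hia | rfl | hia
    · simpa [hia.le, Nat.succ_le_of_lt hia] using hP.2 i (by omega)
    · simpa [show i + 1 + b - i - 1 = b by omega] using harc
    · have := hP.2 (i + b - a - 1) (by omega)
      dsimp only
      rwa [if_neg (by omega), if_neg (by omega),
        show i + 1 + b - a - 1 = i + b - a - 1 + 1 by omega]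
  · dsimp only
    rw [if_neg (by omega)]
    congr 1
    omega

theorem hasDipath_of_detour {A : V → V → Prop} {n : ℕ} {P : ℕ → V} (hP : IsDipathOn A n P)
    {x : V} (hx : ∀ i ≤ n, P i ≠ x) {a b : ℕ} (hab : a < b) (hb : b ≤ n)
    (hax : A (P a) x) (hxb : A x (P b)) : HasDipath A (a + 2 + (n - b)) (P 0) (P n) := by
  refine ⟨fun i => if i ≤ a then P i else if i = a + 1 then x else P (i + b - a - 2),
    ⟨fun i j hi hj hij => ?_, fun i hi => ?_⟩, by simp, ?_⟩
  · have h1 := hP.1 i j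
    have h2 := hP.1 i (j + b - a - 2)
    have h3 := hP.1 (i + b - a - 2) j
    have h4 := hP.1 (i + b - a - 2) (j + b - a - 2)
    have h5 := hx i
    have h6 := hx j
    have h7 := hx (i + b - a - 2)
    have h8 := hx (j + b - a - 2)
    grind
  · rcases lt_trichotomy i a with hia | rfl | hia
    · simpa [hia.le, Nat.succ_le_of_lt hia] using hP.2 i (by omega)
    · simpa using hax
    · rcases eq_or_ne i (a + 1) with rfl | hne
      · simpa [show a + 1 + 1 + b - a - 2 = b by omega] using hxb
      · have := hP.2 (i + b - a - 2) (by omega)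
        dsimp only
        rwa [if_neg (by omega), if_neg hne, if_neg (by omega), if_neg (by omega),
          show i + 1 + b - a - 2 = i + b - a - 2 + 1 by omega]
  · dsimp only
    rw [if_neg (by omega), if_neg (by omega)]
    congr 1
    omega

/-- In a semicomplete bipartite digraph the vertices of a path alternate between the parts. -/
theorem dAdj_iff_of_semicompleteBipartiteOn {A : V → V → Prop} {n : ℕ} {P : ℕ → V}
    (hP : IsDipathOn A n P) (hbip : SemicompleteBipartiteOn A (VertsUpTo n P)) {i j : ℕ}
    (hi : i ≤ n) (hj : j ≤ n) : DAdj A (P i) (P j) ↔ i % 2 ≠ j % 2 := by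
  obtain ⟨X, Y, hU, -, hX, hY, hXY⟩ := hbip
  have hmem : ∀ i ≤ n, P i ∈ X ∨ P i ∈ Y := fun i hi => by
    have : P i ∈ X ∪ Y := hU ▸ ⟨i, hi, rfl⟩
    exact this
  have hdisj : ∀ i j, i ≤ n → j ≤ n → (P i ∈ X ↔ P j ∈ X) → ¬ DAdj A (P i) (P j) := by
    intro i j hi hj hij
    by_cases hc : P i ∈ X
    · exact hX _ hc _ (hij.1 hc)
    · exact hY _ ((hmem i hi).resolve_left hc) _ ((hmem j hj).resolve_left fun h => hc (hij.2 h))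
  have halt : ∀ i ≤ n, (P i ∈ X ↔ (P 0 ∈ X ↔ i % 2 = 0)) := by
    intro i
    induction i with
    | zero => simp
    | succ i ih =>
      intro hi
      have h1 := ih (by omega)
      have h2 := fun h => hdisj i (i + 1) (by omega) hi h (Or.inl (hP.2 i (by omega)))
      have h3 : (i + 1) % 2 = 0 ↔ ¬ i % 2 = 0 := by omega
      tauto
  have hpar : i % 2 = j % 2 ↔ (i % 2 = 0 ↔ j % 2 = 0) := by omega
  have h1 := halt i hi
  have h2 := halt j hj
  constructor
  · intro hadj hij
    exact hdisj i j hi hj (by tauto) hadj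
  · intro hij
    have h3 := hmem i hi
    have h4 := hmem j hj
    by_cases hc : P i ∈ X
    · exact hXY _ hc _ (h4.resolve_left (by tauto))
    · exact (hXY _ (by tauto) _ (h3.resolve_left hc)).symm

theorem bipartiteGeodesic_of_dist {A : V → V → Prop} {k : ℕ} (hk5 : 5 ≤ k) (hkodd : Odd k)
    (hQT : KQuasiTransitive A k) {P : ℕ → V} (hP : IsDipathOn A (k + 2) P)
    (hdist : ∀ m, m < k + 2 → ¬ HasDipath A m (P 0) (P (k + 2)))
    (hbip : SemicompleteBipartiteOn A (VertsUpTo (k + 2) P)) : BipartiteGeodesic A k P where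
  five_le := hk5
  odd := Nat.odd_iff.1 hkodd
  quasi := hQT
  inj := hP.1
  step := hP.2
  back i j hi hji hpar := by
    have := (dAdj_iff_of_semicompleteBipartiteOn hP hbip hi (j := j) (by omega)).2 (by omega)
    refine this.resolve_right fun hc => ?_
    exact hdist _ (by omega) (hasDipath_of_skip hP (by omega) hi hc)
  not_adj i j hi hj hij hadj :=
    (dAdj_iff_of_semicompleteBipartiteOn hP hbip hi hj).1 hadj hij
  detour x a b hx ha hb hax hxb := by
    by_contra hc
    exact hdist _ (by omega) (hasDipath_of_detour hP hx (by omega) hb hax hxb)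

theorem exists_arcs_of_mem_BSet {A : V → V → Prop} {n : ℕ} {P : ℕ → V} {x : V}
    (hx : x ∈ BSet A (VertsUpTo n P)) :
    (∀ i ≤ n, P i ≠ x) ∧ (∃ a ≤ n, A (P a) x) ∧ ∃ b ≤ n, A x (P b) := by
  obtain ⟨hxP, hxI, hxW⟩ := hx
  refine ⟨fun i hi h => hxP ⟨i, hi, h⟩, ?_, ?_⟩
  · by_contra! hc
    exact hxI ⟨hxP, by rintro w ⟨i, hi, rfl⟩; exact hc i hi⟩
  · by_contra! hc
    exact hxW ⟨hxP, by rintro w ⟨i, hi, rfl⟩; exact hc i hi⟩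

/-- All neighbours on `P` of a vertex of `B` have indices of the same parity. -/
theorem BipartiteGeodesic.parity_of_mem_BSet {A : V → V → Prop} {k : ℕ} {P : ℕ → V}
    (h : BipartiteGeodesic A k P) {x : V} (hx : x ∈ BSet A (VertsUpTo (k + 2) P)) {c : ℕ}
    (hc : c ≤ k + 2) (hxc : DAdj A x (P c)) :
    (∀ i ≤ k + 2, P i ≠ x) ∧ (∃ a ≤ k + 2, A (P a) x ∧ a % 2 = c % 2) ∧
      (∃ b ≤ k + 2, A x (P b) ∧ b % 2 = c % 2) := by
  obtain ⟨hxP, ⟨a, ha, hax⟩, b, hb, hxb⟩ := exists_arcs_of_mem_BSet hx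
  have hab := h.parity_in_out hxP ha hb hax hxb
  have hac : a % 2 = c % 2 := by
    rcases hxc with hxc | hcx
    · exact h.parity_in_out hxP ha hc hax hxc
    · exact hab.trans (h.parity_in_out hxP hc hb hcx hxb).symm
  exact ⟨hxP, ⟨a, ha, hax, hac⟩, b, hb, hxb, by omega⟩

theorem stmt_16
    {V : Type*} [Fintype V] (A : V → V → Prop) (hirr : Irreflexive A)
    (k : ℕ) (hk5 : 5 ≤ k) (hkodd : Odd k)
    (hQT : KQuasiTransitive A k) (hstrong : StrongD A)
    (u v : V) (hdist : ∀ m, m < k + 2 → ¬ HasDipath A m u v)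
    (P : ℕ → V) (hP : IsDipathOn A (k + 2) P) (hPu : P 0 = u) (hPv : P (k + 2) = v)
    (hbip : SemicompleteBipartiteOn A (VertsUpTo (k + 2) P)) :
    ∀ B1 B2 : Set V,
      B1 = {x ∈ BSet A (VertsUpTo (k + 2) P) |
        ∃ w ∈ EvenVertsUpTo (k + 2) P, DAdj A x w} →
      B2 = {x ∈ BSet A (VertsUpTo (k + 2) P) |
        ∃ w ∈ OddVertsUpTo (k + 2) P, DAdj A x w} →
      B1 ∩ B2 = ∅ ∧
      (∀ x ∈ B1, ∀ y ∈ B2, DAdj A x y) ∧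
      (∀ x ∈ B1, ∀ y ∈ B1, ¬ DAdj A x y) ∧
      (∀ x ∈ B2, ∀ y ∈ B2, ¬ DAdj A x y) := by
  rintro B1 B2 rfl rfl
  subst hPu hPv
  have h := bipartiteGeodesic_of_dist hk5 hkodd hQT hP hdist hbip
  have hne : ∀ {x y}, A x y → x ≠ y := fun {x y} hxy heq => hirr x (heq ▸ hxy)
  have hsame : ∀ x ∈ BSet A (VertsUpTo (k + 2) P), ∀ y ∈ BSet A (VertsUpTo (k + 2) P),
      ∀ i ≤ k + 2, ∀ j ≤ k + 2, DAdj A x (P i) → DAdj A y (P j) → i % 2 = j % 2 →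
        ¬ DAdj A x y := by
    intro x hx y hy i hi j hj hxi hyj hij
    obtain ⟨hxP, ⟨a, ha, hax, ha2⟩, b, hb, hxb, hb2⟩ := h.parity_of_mem_BSet hx hi hxi
    obtain ⟨hyP, ⟨c, hc, hcy, hc2⟩, d, hd, hyd, hd2⟩ := h.parity_of_mem_BSet hy hj hyj
    rintro (hxy | hyx)
    · exact h.not_arc_of_parity hxP hyP (hne hxy) ha hd hax hyd (by omega) hxy
    · exact h.not_arc_of_parity hyP hxP (hne hyx) hc hb hcy hxb (by omega) hyx
  have hdiff : ∀ x ∈ BSet A (VertsUpTo (k + 2) P), ∀ i ≤ k + 2, ∀ j ≤ k + 2,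
      DAdj A x (P i) → DAdj A x (P j) → i % 2 = j % 2 := by
    intro x hx i hi j hj hxi hxj
    obtain ⟨hxP, ⟨a, ha, hax, ha2⟩, -⟩ := h.parity_of_mem_BSet hx hi hxi
    obtain ⟨-, -, b, hb, hxb, hb2⟩ := h.parity_of_mem_BSet hx hj hxj
    have := h.parity_in_out hxP ha hb hax hxb
    omega
  refine ⟨?_, ?_, ?_, ?_⟩
  · rw [Set.eq_empty_iff_forall_notMem]
    rintro x ⟨⟨hx, -, ⟨i, hi, hi2, rfl⟩, hxi⟩, -, -, ⟨j, hj, hj2, rfl⟩, hxj⟩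
    have := hdiff x hx i hi j hj hxi hxj
    grind
  · rintro x ⟨hx, -, ⟨i, hi, hi2, rfl⟩, hxi⟩ y ⟨hy, -, ⟨j, hj, hj2, rfl⟩, hyj⟩
    rw [Nat.even_iff] at hi2
    rw [Nat.odd_iff] at hj2
    obtain ⟨hxP, ⟨a, ha, hax, ha2⟩, b, hb, hxb, hb2⟩ := h.parity_of_mem_BSet hx hi hxi
    obtain ⟨hyP, ⟨c, hc, hcy, hc2⟩, d, hd, hyd, hd2⟩ := h.parity_of_mem_BSet hy hj hyj
    have hxy : x ≠ y := by
      rintro rfl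
      have := hdiff x hx i hi j hj hxi hyj
      omega
    exact h.adj_of_even_odd hxP hyP hxy ha hb hc hd hax hxb hcy hyd (by omega) (by omega)
      (by omega) (by omega)
  · rintro x ⟨hx, -, ⟨i, hi, hi2, rfl⟩, hxi⟩ y ⟨hy, -, ⟨j, hj, hj2, rfl⟩, hyj⟩
    rw [Nat.even_iff] at hi2 hj2
    exact hsame x hx y hy i hi j hj hxi hyj (by omega)
  · rintro x ⟨hx, -, ⟨i, hi, hi2, rfl⟩, hxi⟩ y ⟨hy, -, ⟨j, hj, hj2, rfl⟩, hyj⟩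
    rw [Nat.odd_iff] at hi2 hj2
    exact hsame x hx y hy i hi j hj hxi hyj (by omega)
end

section
/- Let Q = y_0 y_1 … y_q be a directed path with all vertices in V(D)∖V(P) and q ≤ k−1, and suppose there exists a vertex x_i of P with x_i→y_0. If i and q have the same parity, then y_q is adjacent to some vertex of E(P); if i and q have different parity, then y_q is adjacent to some vertex of O(P). -/
variable {V : Type*}

/-- In a `k`-quasi-transitive digraph, a path of length `l` through vertices of `P` followed by an
arc to the first vertex of a path `Q` of length `q` avoiding `P` makes the two extremities
adjacent when `l + 1 + q = k`. -/
theorem KQuasiTransitive.dAdj_of_concat {V : Type*} {A : V → V → Prop} {k n l q : ℕ}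
    (hQT : KQuasiTransitive A k) {P Q : ℕ → V} (hQ : IsDipathOn A q Q)
    (hdisj : ∀ m ≤ q, Q m ∉ VertsUpTo n P) (hlen : l + 1 + q = k)
    {R : ℕ → V} (hR : IsDipathOn A l R) (hRP : ∀ j ≤ l, R j ∈ VertsUpTo n P)
    (harc : A (R l) (Q 0)) : DAdj A (Q q) (R 0) := by
  have key := hQT (fun j => if j ≤ l then R j else Q (j - (l + 1))) ⟨?_, ?_⟩
  · simp only [Nat.zero_le, if_true, show ¬ k ≤ l by omega, if_false,
      show k - (l + 1) = q by omega] at key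
    exact key.symm
  · intro a b ha hb hab
    by_cases ha' : a ≤ l <;> by_cases hb' : b ≤ l <;> simp only [ha', hb', if_true, if_false] at hab
    · exact hR.1 a b ha' hb' hab
    · exact absurd (hab ▸ hRP a ha') (hdisj _ (by omega))
    · exact absurd (hab ▸ hRP b hb') (hdisj _ (by omega))
    · have := hQ.1 _ _ (by omega) (by omega) hab
      omega
  · intro a ha
    rcases lt_trichotomy a l with h | rfl | h
    · simpa [h.le, Nat.succ_le_of_lt h] using hR.2 a h
    · simpa using harc
    · have := hQ.2 (a - (l + 1)) (by omega)
      simpa [show ¬ a ≤ l by omega, show ¬ a + 1 ≤ l by omega,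
        show a + 1 - (l + 1) = a - (l + 1) + 1 by omega] using this

/-- If the closing arc `P k → P 0` is present, with `k` odd, then every vertex `P i` is the end of a
path of each length `l ≤ k - 1` through vertices of `P`, starting at an index congruent to
`i + l` modulo two. -/
theorem IsDipathOn.exists_dipath_ending_at {V : Type*} {A : V → V → Prop} {k n l i : ℕ}
    (hkodd : Odd k) {P : ℕ → V} (hP : IsDipathOn A n P) (hkn : k ≤ n)
    (hback : A (P k) (P 0)) (hl : l < k) (hi : i ≤ n) :
    ∃ R : ℕ → V, IsDipathOn A l R ∧ (∀ j ≤ l, R j ∈ VertsUpTo n P) ∧ R l = P i ∧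
      ∃ s ≤ n, s % 2 = (i + l) % 2 ∧ R 0 = P s := by
  obtain ⟨t, rfl⟩ := hkodd
  by_cases h : l ≤ i
  · refine ⟨fun j => P (i - l + j), ⟨fun a b ha hb hab => ?_, fun a ha => ?_⟩,
      fun j hj => ⟨_, by omega, rfl⟩, by simp [h], i - l, by omega, by omega, rfl⟩
    · have := hP.1 _ _ (by omega) (by omega) hab
      omega
    · exact hP.2 (i - l + a) (by omega)
  · refine ⟨fun j => P (if j < l - i then 2 * t + 1 + 1 + i - l + j else j - (l - i)),
      ⟨fun a b ha hb hab => ?_, fun a ha => ?_⟩, fun j hj => ⟨_, by split_ifs <;> omega, rfl⟩,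
      ?_, 2 * t + 1 + 1 + i - l, by omega, by omega, by simp [show i < l by omega]⟩
    · have := hP.1 _ _ (by split_ifs <;> omega) (by split_ifs <;> omega) hab
      split_ifs at this <;> omega
    · rcases lt_trichotomy (a + 1) (l - i) with h' | h' | h'
      · simpa [h', show a < l - i by omega, add_assoc] using
          hP.2 (2 * t + 1 + 1 + i - l + a) (by omega)
      · simpa [h', show a < l - i by omega,
          show 2 * t + 1 + 1 + i - l + a = 2 * t + 1 by omega] using hback
      · simpa [show ¬ a + 1 < l - i by omega, show ¬ a < l - i by omega,
          show a + 1 - (l - i) = a - (l - i) + 1 by omega] using hP.2 (a - (l - i)) (by omega)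
    · simp only [show ¬ l < l - i by omega, if_false, show l - (l - i) = i by omega]

/-- A path of length `k + 2` between vertices at distance `k + 2` in a `k`-quasi-transitive
digraph has the arc from its `k`-th vertex to its initial vertex. -/
theorem KQuasiTransitive.arc_to_start {V : Type*} {A : V → V → Prop} {k : ℕ} (hk : 2 ≤ k)
    (hQT : KQuasiTransitive A k) {P : ℕ → V} (hP : IsDipathOn A (k + 2) P)
    (hdist : ∀ m, m < k + 2 → ¬ HasDipath A m (P 0) (P (k + 2))) : A (P k) (P 0) := by
  refine (hQT P ⟨fun a b ha hb => hP.1 a b (by omega) (by omega),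
    fun a ha => hP.2 a (by omega)⟩).resolve_left fun hforward => ?_
  refine hdist 3 (by omega) ⟨fun j => P (if j = 0 then 0 else k - 1 + j),
    ⟨fun a b ha hb hab => ?_, fun a ha => ?_⟩, by simp, by
      simp [show k - 1 + 3 = k + 2 by omega]⟩
  · have := hP.1 _ _ (by split_ifs <;> omega) (by split_ifs <;> omega) hab
    split_ifs at this <;> omega
  · rcases Nat.eq_zero_or_pos a with rfl | h
    · simpa [show k - 1 + 1 = k by omega] using hforward
    · simpa [h.ne', add_assoc] using hP.2 (k - 1 + a) (by omega)

theorem stmt_17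
    {V : Type*} [Fintype V] (A : V → V → Prop) (hirr : Irreflexive A)
    (k : ℕ) (hk5 : 5 ≤ k) (hkodd : Odd k)
    (hQT : KQuasiTransitive A k) (hstrong : StrongD A)
    (u v : V) (hdist : ∀ m, m < k + 2 → ¬ HasDipath A m u v)
    (P : ℕ → V) (hP : IsDipathOn A (k + 2) P) (hPu : P 0 = u) (hPv : P (k + 2) = v) :
    ∀ (q : ℕ) (Q : ℕ → V), q ≤ k - 1 → IsDipathOn A q Q →
      (∀ m ≤ q, Q m ∉ VertsUpTo (k + 2) P) →
      ∀ i ≤ k + 2, A (P i) (Q 0) →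
        (i % 2 = q % 2 → ∃ w ∈ EvenVertsUpTo (k + 2) P, DAdj A (Q q) w) ∧
        (i % 2 ≠ q % 2 → ∃ w ∈ OddVertsUpTo (k + 2) P, DAdj A (Q q) w) := by
  subst hPu hPv
  intro q Q hq hQ hdisj i hi harc
  obtain ⟨R, hR, hRP, hRi, s, hs, hsi, hRs⟩ := hP.exists_dipath_ending_at (l := k - 1 - q) hkodd
    (by omega) (hQT.arc_to_start (by omega) hP hdist) (by omega) hi
  have hadj := hQT.dAdj_of_concat hQ hdisj (by omega) hR hRP (hRi ▸ harc)
  rw [hRs] at hadj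
  obtain ⟨t, rfl⟩ := hkodd
  exact ⟨fun h => ⟨P s, ⟨s, hs, Nat.even_iff.2 (by omega), rfl⟩, hadj⟩,
    fun h => ⟨P s, ⟨s, hs, Nat.odd_iff.2 (by omega), rfl⟩, hadj⟩⟩
end

section
/- There is no arc from any vertex of W to any vertex of I; that is, (W, I) = ∅. -/
variable {V : Type*}

/-- There is a directed path of length `n` from `u` to `v` all of whose vertices lie in `S`. -/
def HasDipathIn {V : Type*} (A : V → V → Prop) (S : Set V) (n : ℕ) (u v : V) : Prop :=
  ∃ f : ℕ → V, IsDipathOn A n f ∧ f 0 = u ∧ f n = v ∧ ∀ i ≤ n, f i ∈ S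

namespace HasDipathIn

variable {V : Type*} {A : V → V → Prop}

theorem hasDipath {S : Set V} {n : ℕ} {u v : V} (h : HasDipathIn A S n u v) :
    HasDipath A n u v := by
  obtain ⟨f, hf, h0, h1, -⟩ := h
  exact ⟨f, hf, h0, h1⟩

theorem mono {S T : Set V} {n : ℕ} {u v : V} (h : HasDipathIn A S n u v) (hST : S ⊆ T) :
    HasDipathIn A T n u v := by
  obtain ⟨f, hf, h0, h1, h2⟩ := h
  exact ⟨f, hf, h0, h1, fun i hi => hST (h2 i hi)⟩

theorem singleton (w : V) : HasDipathIn A {w} 0 w w :=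
  ⟨fun _ => w, ⟨fun i j hi hj _ => by omega, fun i hi => by omega⟩, rfl, rfl, fun _ _ => rfl⟩

theorem segment {n : ℕ} {f : ℕ → V} (hf : IsDipathOn A n f) (i l j : ℕ) (hj : i + l = j)
    (hjn : j ≤ n) : HasDipathIn A (f '' Set.Icc i j) l (f i) (f j) := by
  subst hj
  refine ⟨fun t => f (i + t), ⟨fun a b ha hb hab => ?_, fun a ha => ?_⟩, rfl, rfl,
    fun t ht => ⟨i + t, ⟨by omega, by omega⟩, rfl⟩⟩
  · have := hf.1 (i + a) (i + b) (by omega) (by omega) hab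
    omega
  · exact hf.2 (i + a) (by omega)

theorem append {S T : Set V} {n m : ℕ} {u v w z : V} (h₁ : HasDipathIn A S n u v)
    (h₂ : HasDipathIn A T m w z) (harc : A v w) (hST : Disjoint S T) :
    HasDipathIn A (S ∪ T) (n + 1 + m) u z := by
  obtain ⟨f, hf, hf0, hfn, hfS⟩ := h₁
  obtain ⟨g, hg, hg0, hgm, hgT⟩ := h₂
  have hne : ∀ i ≤ n, ∀ j ≤ m, f i ≠ g j := fun i hi j hj hij =>
    Set.disjoint_left.1 hST (hfS i hi) (hij ▸ hgT j hj)
  refine ⟨fun t => if t ≤ n then f t else g (t - (n + 1)), ⟨fun i j hi hj hij => ?_,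
    fun i hi => ?_⟩, ?_, ?_, fun i hi => ?_⟩
  · dsimp only at hij
    split_ifs at hij with h1 h2 h2
    · exact hf.1 i j h1 h2 hij
    · exact absurd hij (hne i h1 _ (by omega))
    · exact absurd hij.symm (hne j h2 _ (by omega))
    · have := hg.1 _ _ (by omega) (by omega) hij
      omega
  · dsimp only
    rcases lt_trichotomy i n with h | h | h
    · rw [if_pos (by omega), if_pos (by omega)]
      exact hf.2 i h
    · subst h
      rw [if_pos le_rfl, if_neg (by omega), Nat.sub_self, hfn, hg0]
      exact harc
    · rw [if_neg (by omega), if_neg (by omega)]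
      have := hg.2 (i - (n + 1)) (by omega)
      rwa [show i - (n + 1) + 1 = i + 1 - (n + 1) by omega] at this
  · simpa using hf0
  · dsimp only
    rw [if_neg (by omega), Nat.add_sub_cancel_left, hgm]
  · dsimp only
    split_ifs with h
    · exact Or.inl (hfS i h)
    · exact Or.inr (hgT _ (by omega))

theorem dAdj {S : Set V} {k n : ℕ} {u v : V} (hQT : KQuasiTransitive A k)
    (h : HasDipathIn A S n u v) (hn : n = k) : DAdj A u v := by
  subst hn
  obtain ⟨f, hf, h0, h1, -⟩ := h
  rw [← h0, ← h1]
  exact hQT f hf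

end HasDipathIn

section

variable {V : Type*} {A : V → V → Prop}

theorem IsDipathOn.disjoint_image_Icc {n : ℕ} {f : ℕ → V} (hf : IsDipathOn A n f)
    {a b c d : ℕ} (hb : b ≤ n) (hd : d ≤ n) (h : b < c ∨ d < a) :
    Disjoint (f '' Set.Icc a b) (f '' Set.Icc c d) := by
  rw [Set.disjoint_left]
  rintro _ ⟨i, ⟨hi1, hi2⟩, rfl⟩ ⟨j, ⟨hj1, hj2⟩, hij⟩
  have := hf.1 j i (by omega) (by omega) hij
  omega

theorem IsDipathOn.reverse {n : ℕ} {f : ℕ → V} (hf : IsDipathOn A n f) :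
    IsDipathOn (flip A) n (fun i => f (n - i)) := by
  refine ⟨fun i j hi hj hij => ?_, fun i hi => ?_⟩
  · have := hf.1 _ _ (by omega) (by omega) hij
    omega
  · have := hf.2 (n - (i + 1)) (by omega)
    rwa [show n - (i + 1) + 1 = n - i by omega] at this

theorem KQuasiTransitive.flip {k : ℕ} (h : KQuasiTransitive A k) :
    KQuasiTransitive (flip A) k := by
  intro f hf
  have := h _ hf.reverse
  simpa [DAdj, _root_.flip] using this

theorem image_Icc_subset_vertsUpTo (n : ℕ) (P : ℕ → V) (a b : ℕ) (hb : b ≤ n) :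
    P '' Set.Icc a b ⊆ VertsUpTo n P := by
  rintro _ ⟨i, ⟨-, hi⟩, rfl⟩
  exact ⟨i, hi.trans hb, rfl⟩

theorem vertsUpTo_reverse (n : ℕ) (P : ℕ → V) :
    VertsUpTo n (fun i => P (n - i)) = VertsUpTo n P := by
  ext w
  constructor
  · rintro ⟨i, hi, rfl⟩
    exact ⟨n - i, by omega, rfl⟩
  · rintro ⟨i, hi, rfl⟩
    exact ⟨n - i, by omega, by simp [Nat.sub_sub_self hi]⟩

/-- Along a shortest path there are no forward arcs other than those of the path. -/
theorem not_arc_of_shortest {n : ℕ} {P : ℕ → V} (hP : IsDipathOn A n P)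
    (hdist : ∀ m, m < n → ¬ HasDipath A m (P 0) (P n)) {a b : ℕ} (hab : a + 1 < b)
    (hb : b ≤ n) : ¬ A (P a) (P b) := fun h =>
  hdist (a + 1 + (n - b)) (by omega)
    ((HasDipathIn.segment hP 0 a a (by omega) (by omega)).append
      (HasDipathIn.segment hP b (n - b) n (by omega) le_rfl) h
      (hP.disjoint_image_Icc (by omega) le_rfl (Or.inl (by omega)))).hasDipath

/-- A path of length `k + 2` in a `k`-quasi-transitive digraph, together with the backward arcs
that are forced when the path is a shortest one. -/
structure IsBackPath (A : V → V → Prop) (k : ℕ) (P : ℕ → V) : Prop where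
  five_le : 5 ≤ k
  quasiTransitive : KQuasiTransitive A k
  isDipathOn : IsDipathOn A (k + 2) P
  arc_k_zero : A (P k) (P 0)
  arc_last_two : A (P (k + 2)) (P 2)
  arc_last_zero : A (P (k + 2)) (P 0)

theorem isBackPath_of_shortest {k : ℕ} (hk : 5 ≤ k) (hQT : KQuasiTransitive A k) {P : ℕ → V}
    (hP : IsDipathOn A (k + 2) P)
    (hdist : ∀ m, m < k + 2 → ¬ HasDipath A m (P 0) (P (k + 2))) : IsBackPath A k P := by
  have h1 : A (P k) (P 0) :=
    ((HasDipathIn.segment hP 0 k k (by omega) (by omega)).dAdj hQT rfl).resolve_left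
      (not_arc_of_shortest hP hdist (by omega) (by omega))
  have h2 : A (P (k + 2)) (P 2) :=
    ((HasDipathIn.segment hP 2 k (k + 2) (by omega) (by omega)).dAdj hQT rfl).resolve_left
      (not_arc_of_shortest hP hdist (by omega) (by omega))
  refine ⟨hk, hQT, hP, h1, h2, ?_⟩
  have hpath := ((HasDipathIn.segment hP (k + 2) 0 (k + 2) (by omega) le_rfl).append
    (HasDipathIn.segment hP 2 (k - 2) k (by omega) (by omega)) h2
    (hP.disjoint_image_Icc le_rfl (by omega) (Or.inr (by omega)))).append
    (HasDipathIn.segment hP 0 0 0 rfl (by omega)) h1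
    (Set.disjoint_union_left.2 ⟨hP.disjoint_image_Icc le_rfl (by omega) (Or.inr (by omega)),
      hP.disjoint_image_Icc (by omega) (by omega) (Or.inr (by omega))⟩)
  exact (hpath.dAdj hQT (by omega)).resolve_right
    (not_arc_of_shortest hP hdist (by omega) (by omega))

namespace IsBackPath

variable {k : ℕ} {P : ℕ → V}

theorem reverse (h : IsBackPath A k P) : IsBackPath (flip A) k (fun i => P (k + 2 - i)) where
  five_le := h.five_le
  quasiTransitive := h.quasiTransitive.flip
  isDipathOn := h.isDipathOn.reverse
  arc_k_zero := by simpa [flip] using h.arc_last_two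
  arc_last_two := by simpa [flip] using h.arc_k_zero
  arc_last_zero := by simpa [flip] using h.arc_last_zero

theorem exists_hasDipathIn_to (h : IsBackPath A k P) {p : V} (hp : p ∈ VertsUpTo (k + 2) P)
    {l : ℕ} (hl : l ≤ k + 2) :
    ∃ q ∈ VertsUpTo (k + 2) P, HasDipathIn A (VertsUpTo (k + 2) P) l q p := by
  obtain ⟨i, hi, rfl⟩ := hp
  have hP := h.isDipathOn
  by_cases hli : l ≤ i
  · exact ⟨_, ⟨i - l, by omega, rfl⟩, (HasDipathIn.segment hP (i - l) l i (by omega) hi).mono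
      (image_Icc_subset_vertsUpTo _ _ _ _ hi)⟩
  · refine ⟨_, ⟨k + 3 + i - l, by omega, rfl⟩, ?_⟩
    have hpath := ((HasDipathIn.segment hP (k + 3 + i - l) (l - i - 1) (k + 2) (by omega)
      le_rfl).append (HasDipathIn.segment hP 0 i i (by omega) hi) h.arc_last_zero
      (hP.disjoint_image_Icc le_rfl hi (Or.inr (by omega)))).mono
      (Set.union_subset (image_Icc_subset_vertsUpTo _ _ _ _ le_rfl)
        (image_Icc_subset_vertsUpTo _ _ _ _ hi))
    rwa [show l - i - 1 + 1 + i = l by omega] at hpath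

theorem exists_hasDipathIn_from (h : IsBackPath A k P) {p : V} (hp : p ∈ VertsUpTo (k + 2) P)
    {l : ℕ} (hl : l ≤ k + 2) :
    ∃ q ∈ VertsUpTo (k + 2) P, HasDipathIn A (VertsUpTo (k + 2) P) l p q := by
  obtain ⟨i, hi, rfl⟩ := hp
  have hP := h.isDipathOn
  by_cases hli : i + l ≤ k + 2
  · exact ⟨_, ⟨i + l, by omega, rfl⟩, (HasDipathIn.segment hP i l (i + l) rfl hli).mono
      (image_Icc_subset_vertsUpTo _ _ _ _ hli)⟩
  · refine ⟨_, ⟨i + l - (k + 3), by omega, rfl⟩, ?_⟩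
    have hpath := ((HasDipathIn.segment hP i (k + 2 - i) (k + 2) (by omega)
      le_rfl).append (HasDipathIn.segment hP 0 (i + l - (k + 3)) (i + l - (k + 3)) (by omega)
      (by omega)) h.arc_last_zero
      (hP.disjoint_image_Icc le_rfl (by omega) (Or.inr (by omega)))).mono
      (Set.union_subset (image_Icc_subset_vertsUpTo _ _ _ _ le_rfl)
        (image_Icc_subset_vertsUpTo _ _ _ _ (by omega)))
    rwa [show k + 2 - i + 1 + (i + l - (k + 3)) = l by omega] at hpath

/-- Every vertex outside the path is adjacent to some vertex of the path. -/
theorem exists_adj (h : IsBackPath A k P) (hstrong : StrongD A) {z : V}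
    (hz : z ∉ VertsUpTo (k + 2) P) :
    (∃ p ∈ VertsUpTo (k + 2) P, A p z) ∨ ∃ p ∈ VertsUpTo (k + 2) P, A z p := by
  classical
  have hk := h.five_le
  have hQT := h.quasiTransitive
  have hex : ∃ d, ∃ p ∈ VertsUpTo (k + 2) P, HasDipath A d p z := by
    obtain ⟨n, hn⟩ := hstrong (P 0) z
    exact ⟨n, P 0, ⟨0, by omega, rfl⟩, hn⟩
  obtain ⟨d, ⟨p, hp, a, ha, rfl, rfl⟩, hmin⟩ :
      ∃ d, (∃ p ∈ VertsUpTo (k + 2) P, HasDipath A d p z) ∧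
        ∀ m < d, ¬ ∃ p ∈ VertsUpTo (k + 2) P, HasDipath A m p z :=
    ⟨Nat.find hex, Nat.find_spec hex, fun m hm => Nat.find_min hex hm⟩
  have hout : ∀ i, 1 ≤ i → i ≤ d → a i ∉ VertsUpTo (k + 2) P := fun i h1 h2 hi =>
    hmin (d - i) (by omega)
      ⟨_, hi, (HasDipathIn.segment ha i (d - i) d (by omega) le_rfl).hasDipath⟩
  have hdisj : ∀ i j, 1 ≤ i → j ≤ d → Disjoint (a '' Set.Icc i j) (VertsUpTo (k + 2) P) := by
    intro i j hi hj
    rw [Set.disjoint_left]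
    rintro _ ⟨t, ⟨ht1, ht2⟩, rfl⟩
    exact hout t (by omega) (by omega)
  have hlayer : ∀ j, 2 ≤ j → j ≤ d → ∀ q ∈ VertsUpTo (k + 2) P, ¬ A q (a j) := by
    intro j h2 hj q hq hqa
    have hpath := (HasDipathIn.singleton (A := A) q).append
      (HasDipathIn.segment ha j (d - j) d (by omega) le_rfl) hqa
      (Set.disjoint_of_subset_left (Set.singleton_subset_iff.2 hq)
        (hdisj j d (by omega) le_rfl).symm)
    exact hmin _ (by omega) ⟨q, hq, hpath.hasDipath⟩
  have hchord : ∀ i j, i + 1 < j → j ≤ d → ¬ A (a i) (a j) := fun i j hij hj =>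
    not_arc_of_shortest ha (fun m hm hm' => hmin m hm ⟨_, hp, hm'⟩) hij hj
  have hback : ∀ j, 2 ≤ j → j ≤ d → ∃ q ∈ VertsUpTo (k + 2) P, A (a j) q := by
    intro j
    induction j using Nat.strong_induction_on with
    | _ j ih =>
    intro h2 hj
    by_cases hjk : j ≤ k
    · obtain ⟨q, hq, hqp⟩ := h.exists_hasDipathIn_to hp (l := k - j) (by omega)
      have hpath := hqp.append (HasDipathIn.segment ha 1 (j - 1) j (by omega) hj)
        (ha.2 0 (by omega)) (hdisj 1 j le_rfl hj).symm
      exact ⟨q, hq, (hpath.dAdj hQT (by omega)).resolve_left (hlayer j h2 hj q hq)⟩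
    · have harc : A (a j) (a (j - k)) :=
        ((HasDipathIn.segment ha (j - k) k j (by omega) hj).dAdj hQT rfl).resolve_left
          (hchord _ _ (by omega) hj)
      by_cases hj1 : j - k = 1
      · obtain ⟨q, hq, hq2⟩ := ih 2 (by omega) le_rfl (by omega)
        obtain ⟨r, hr, hqr⟩ := h.exists_hasDipathIn_from hq (l := k - 3) (by omega)
        rw [hj1] at harc
        have hpath := ((HasDipathIn.segment ha j 0 j (by omega) hj).append
          (HasDipathIn.segment ha 1 1 2 (by omega) (by omega)) harc
          (ha.disjoint_image_Icc hj (by omega) (Or.inr (by omega)))).append hqr hq2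
          (Set.disjoint_union_left.2 ⟨hdisj _ _ (by omega) hj, hdisj _ _ le_rfl (by omega)⟩)
        exact ⟨r, hr, (hpath.dAdj hQT (by omega)).resolve_right (hlayer j h2 hj r hr)⟩
      · obtain ⟨q, hq, hq2⟩ := ih (j - k) (by omega) (by omega) (by omega)
        obtain ⟨r, hr, hqr⟩ := h.exists_hasDipathIn_from hq (l := k - 2) (by omega)
        have hpath := ((HasDipathIn.segment ha j 0 j (by omega) hj).append
          (HasDipathIn.segment ha (j - k) 0 (j - k) (by omega) (by omega)) harc
          (ha.disjoint_image_Icc hj (by omega) (Or.inr (by omega)))).append hqr hq2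
          (Set.disjoint_union_left.2
            ⟨hdisj _ _ (by omega) hj, hdisj _ _ (by omega) (by omega)⟩)
        exact ⟨r, hr, (hpath.dAdj hQT (by omega)).resolve_right (hlayer j h2 hj r hr)⟩
  rcases Nat.lt_or_ge d 2 with hd | hd
  · interval_cases d
    · exact absurd hp hz
    · exact Or.inl ⟨_, hp, ha.2 0 (by omega)⟩
  · exact Or.inr (hback d hd le_rfl)

/-- A vertex outside the path sending no arc to it is dominated by one of the first two vertices
of the path. -/
theorem exists_le_one_arc (h : IsBackPath A k P) (hstrong : StrongD A) {x : V}
    (hx : x ∈ WSet A (VertsUpTo (k + 2) P)) : ∃ a ≤ 1, A (P a) x := by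
  obtain ⟨hxP, hxW⟩ := hx
  have hk := h.five_le
  have hP := h.isDipathOn
  have extend : ∀ S ⊆ VertsUpTo (k + 2) P, ∀ m i n, m ≤ k + 2 → n + 1 = k →
      HasDipathIn A S n (P m) (P i) → A (P i) x → A (P m) x := by
    intro S hS m i n hm hn hpath hix
    have hpath' := hpath.append (HasDipathIn.singleton (A := A) x) hix
      (Set.disjoint_singleton_right.2 fun hxS => hxP (hS hxS))
    exact (hpath'.dAdj h.quasiTransitive (by omega)).resolve_right (hxW _ ⟨m, hm, rfl⟩)
  have shift : ∀ m i, m + (k - 1) = i → i ≤ k + 2 → A (P i) x → A (P m) x :=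
    fun m i hmi hi => extend _ (image_Icc_subset_vertsUpTo _ _ _ _ hi) m i (k - 1) (by omega)
      (by omega) (HasDipathIn.segment hP m (k - 1) i hmi hi)
  have step : ∀ i, 2 ≤ i → i ≤ k → A (P i) x → A (P (i + 2)) x := by
    intro i hi2 hik
    exact extend _ (Set.union_subset (image_Icc_subset_vertsUpTo _ _ _ _ le_rfl)
        (image_Icc_subset_vertsUpTo _ _ _ _ (by omega))) (i + 2) i (k - i + 1 + (i - 2))
      (by omega) (by omega)
      ((HasDipathIn.segment hP (i + 2) (k - i) (k + 2) (by omega) le_rfl).append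
        (HasDipathIn.segment hP 2 (i - 2) i (by omega) (by omega)) h.arc_last_two
        (hP.disjoint_image_Icc le_rfl (by omega) (Or.inr (by omega))))
  have climb : ∀ n i, i + n = k → A (P i) x → ∃ a ≤ 1, A (P a) x := by
    intro n
    induction n using Nat.strong_induction_on with
    | _ n ih =>
    intro i hin hix
    rcases Nat.lt_or_ge i 2 with hi | hi
    · exact ⟨i, by omega, hix⟩
    rcases Nat.lt_or_ge n 2 with hn | hn
    · exact ⟨i - (k - 1), by omega, shift _ i (by omega) (by omega) hix⟩
    · exact ih (n - 2) (by omega) (i + 2) (by omega) (step i hi (by omega) hix)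
  obtain ⟨_, ⟨i, hi, rfl⟩, hix⟩ : ∃ p ∈ VertsUpTo (k + 2) P, A p x :=
    (h.exists_adj hstrong hxP).resolve_right fun ⟨p, hp, hxp⟩ => hxW p hp hxp
  by_cases hik : i ≤ k
  · exact climb (k - i) i (by omega) hix
  · exact climb (k - (i - (k - 1))) (i - (k - 1)) (by omega) (shift _ i (by omega) hi hix)

end IsBackPath

theorem StrongD.flip (h : StrongD A) : StrongD (flip A) := by
  intro u v
  obtain ⟨n, f, hf, h0, hn⟩ := h v u
  exact ⟨n, _, hf.reverse, by simpa using hn, by simpa using h0⟩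

end

theorem stmt_18
    {V : Type*} [Fintype V] (A : V → V → Prop) (hirr : Irreflexive A)
    (k : ℕ) (hk5 : 5 ≤ k) (hkodd : Odd k)
    (hQT : KQuasiTransitive A k) (hstrong : StrongD A)
    (u v : V) (hdist : ∀ m, m < k + 2 → ¬ HasDipath A m u v)
    (P : ℕ → V) (hP : IsDipathOn A (k + 2) P) (hPu : P 0 = u) (hPv : P (k + 2) = v) :
    ∀ x ∈ WSet A (VertsUpTo (k + 2) P), ∀ y ∈ ISet A (VertsUpTo (k + 2) P),
      ¬ A x y := by
  subst hPu hPv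
  intro x hx y hy hxy
  have h := isBackPath_of_shortest hk5 hQT hP hdist
  obtain ⟨a, ha, hax⟩ := h.exists_le_one_arc hstrong hx
  obtain ⟨c, hc, hcy⟩ : ∃ c ≤ 1, flip A (P (k + 2 - c)) y :=
    h.reverse.exists_le_one_arc hstrong.flip (x := y) (by rw [vertsUpTo_reverse]; exact hy)
  have hxy' : x ≠ y := by
    rintro rfl
    exact hirr x hxy
  have houtx : ∀ i j, j ≤ k + 2 → x ∉ P '' Set.Icc i j := fun i j hj hi =>
    hx.1 (image_Icc_subset_vertsUpTo _ _ _ _ hj hi)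
  have houty : ∀ i j, j ≤ k + 2 → y ∉ P '' Set.Icc i j := fun i j hj hi =>
    hy.1 (image_Icc_subset_vertsUpTo _ _ _ _ hj hi)
  have hpath := ((HasDipathIn.segment hP 0 a a (by omega) (by omega)).append
    (HasDipathIn.singleton x) hax
    (Set.disjoint_singleton_right.2 (houtx _ _ (by omega)))).append
    ((HasDipathIn.singleton y).append
      (HasDipathIn.segment hP (k + 2 - c) c (k + 2) (by omega) le_rfl) hcy
      (Set.disjoint_singleton_left.2 (houty _ _ le_rfl))) hxy
    (by
      rw [Set.disjoint_union_left, Set.disjoint_union_right, Set.disjoint_union_right]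
      exact ⟨⟨Set.disjoint_singleton_right.2 (houty _ _ (by omega)),
        hP.disjoint_image_Icc (by omega) le_rfl (Or.inl (by omega))⟩,
        Set.disjoint_singleton.2 hxy', Set.disjoint_singleton_left.2 (houtx _ _ le_rfl)⟩)
  exact hdist _ (by omega) hpath.hasDipath
end
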